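/- (Treutlein) Let P ⊂ ℝ^d be a lattice polytope of dimension d and suppose there exist nonnegative integers h_1^*, h_2^* such that #(nP ∩ ℤ^d) = C(n+d, d) + h_1^*·C(n+d−1, d) + h_2^*·C(n+d−2, d) for every integer n ≥ 1 (i.e., P has degree at most 2 with h*-polynomial 1 + h_1^* t + h_2^* t^2). Then at least one of the following holds: (1) h_2^* = 0; (2) h_1^* ≤ 3h_2^* + 3; (3) h_1^* = 7 and h_2^* = 1. -/

import Mathlib

open scoped Pointwise

/-- The coercion of an integer point to a real point. -/
def toReal {d : ℕ} (x : Fin d → ℤ) : Fin d → ℝ := fun i => (x i : ℝ)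

/-- The number of lattice points in the `n`-th dilation of `P ⊆ ℝ^d`. -/
noncomputable def latticeCount {d : ℕ} (P : Set (Fin d → ℝ)) (n : ℕ) : ℕ :=
  Set.ncard {x : Fin d → ℤ | toReal x ∈ (n : ℝ) • P}

/-- The finite abelian group `Λ_Δ` attached to a lattice simplex with vertices `v`. -/
def Lambda {d : ℕ} (v : Fin (d + 1) → Fin d → ℤ) : Set (Fin (d + 1) → ℝ) :=
  {r | (∀ j, 0 ≤ r j ∧ r j < 1) ∧
    (∀ i : Fin d, ∃ z : ℤ, ∑ j, r j * (v j i : ℝ) = (z : ℝ)) ∧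
    (∃ z : ℤ, ∑ j, r j = (z : ℝ))}

/-- The height `ht(α) = ∑ᵢ αᵢ`. -/
def ht {m : ℕ} (α : Fin m → ℝ) : ℝ := ∑ i, α i

/-- The support `supp(α) = {i : αᵢ > 0}`. -/
def suppOf {m : ℕ} (α : Fin m → ℝ) : Set (Fin m) := {i | 0 < α i}

/-- Addition on `Λ_Δ`: coordinatewise fractional part of the sum. -/
noncomputable def fadd {m : ℕ} (α β : Fin m → ℝ) : Fin m → ℝ := fun i => Int.fract (α i + β i)

/-- Negation on `Λ_Δ`: coordinatewise fractional part of `1 - αᵢ`. -/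
noncomputable def fneg {m : ℕ} (α : Fin m → ℝ) : Fin m → ℝ := fun i => Int.fract (1 - α i)

/-- `P ⊆ ℝ^d` is a lattice polytope of dimension `d`: the convex hull of a finite
set of lattice points whose affine span is all of `ℝ^d`. -/
def IsFullDimLatticePolytope {d : ℕ} (P : Set (Fin d → ℝ)) : Prop :=
  ∃ V : Finset (Fin d → ℤ),
    P = convexHull ℝ (toReal '' (V : Set (Fin d → ℤ))) ∧ affineSpan ℝ P = ⊤

section Treutlein

open Finset Module
open scoped Classical

variable {V : Type*} [AddCommGroup V] [Module ℝ V]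

/-- The dimension of the affine span of a finite set. -/
noncomputable def affRank (A : Finset V) : ℕ := finrank ℝ (vectorSpan ℝ (A : Set V))

/-- The number of points of a finite set beyond those of an affine basis of its span. -/
noncomputable def surplus (A : Finset V) : ℤ := #A - affRank A - 1

/-- Twice the difference between `#(A + A)` and Freiman's lower bound for it. -/
noncomputable def doublingExcess (A : Finset V) : ℤ :=
  2 * #(A + A) - 2 * (affRank A + 1) * #A + affRank A * (affRank A + 1)

/-- A finite subset of `Λ` containing every element of `Λ` on a segment between two of its
points. -/
def IsSegmentClosed (Λ : AddSubgroup V) (A : Finset V) : Prop :=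
  (∀ x ∈ A, x ∈ Λ) ∧ ∀ x ∈ A, ∀ y ∈ A, ∀ z ∈ Λ, z ∈ segment ℝ x y → z ∈ A

/-- A point of `A` at which some linear functional has its unique minimum on `A`. -/
def IsVertex (A : Finset V) (v : V) : Prop :=
  v ∈ A ∧ ∃ f : V →ₗ[ℝ] ℝ, ∀ x ∈ A, x ≠ v → f v < f x

/-- The points `w ≠ v` of `A` for which `w - v` is not a sum of two nonzero elements of `A - v`. -/
noncomputable def irreducibles (A : Finset V) (v : V) : Finset V :=
  {w ∈ A | w ≠ v ∧ ∀ a ∈ A, ∀ b ∈ A, a ≠ v → b ≠ v → a + b ≠ v + w}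

/-- The direction classes of points modulo a vector. -/
noncomputable abbrev lineClass (y : V) : V →ₗ[ℝ] V ⧸ Submodule.span ℝ {y} :=
  (Submodule.span ℝ {y}).mkQ

/-- `A` is covered by `affRank A` parallel lines. -/
def CoveredByLines (A : Finset V) : Prop :=
  ∃ y : V, y ≠ 0 ∧ #(A.image (lineClass y)) ≤ affRank A

theorem lineClass_eq_iff {y a b : V} : lineClass y a = lineClass y b ↔ ∃ t : ℝ, a = b + t • y := by
  rw [Submodule.mkQ_apply, Submodule.mkQ_apply, Submodule.Quotient.eq,
    Submodule.mem_span_singleton]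
  constructor
  · rintro ⟨t, ht⟩
    exact ⟨t, by rw [ht]; abel⟩
  · rintro ⟨t, rfl⟩
    exact ⟨t, by abel⟩

theorem card_add_card_le_card_add {X Y : Finset V} (hX : X.Nonempty) (hY : Y.Nonempty) :
    #X + #Y ≤ #(X + Y) + 1 := by
  let _ : Module ℚ V := Module.compHom V (algebraMap ℚ ℝ)
  have : IsAddTorsionFree V := .of_module_rat V
  have := cauchy_davenport_of_isAddTorsionFree hX hY
  omega

theorem exists_isVertex {A : Finset V} (hA : A.Nonempty) : ∃ v, IsVertex A v := by
  obtain ⟨f, hf⟩ := Module.exists_dual_forall_apply_ne_zero (K := ℝ)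
    (fun p : {p : A × A // p.1 ≠ p.2} => (p.1.1 : V) - p.1.2)
    (fun p => sub_ne_zero.mpr fun h => p.2 (Subtype.ext h))
  obtain ⟨v, hv, hmin⟩ := A.exists_min_image f hA
  refine ⟨v, hv, f, fun x hx hxv => lt_of_le_of_ne (hmin x hx) fun h => ?_⟩
  refine hf ⟨(⟨x, hx⟩, ⟨v, hv⟩), fun h' => hxv (congrArg Subtype.val h')⟩ ?_
  simp [h]

/-- Adding a set on one line to `B` gains in each of the parallel lines meeting `B`. -/
theorem card_add_of_const {W : Type*} [AddCommGroup W] (π : V →+ W) {E : Finset V} (B : Finset V)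
    (hE : E.Nonempty) {q : W} (hq : ∀ x ∈ E, π x = q) :
    #B + #(B.image π) * #E ≤ #(E + B) + #(B.image π) := by
  have hsub : (B.image π).biUnion (fun p => E + B.filter (fun x => π x = p)) ⊆ E + B := by
    refine biUnion_subset.mpr fun p _ => add_subset_add_left (filter_subset _ _)
  have hcard := card_le_card hsub
  rw [card_biUnion] at hcard
  · have hB : #B = ∑ p ∈ B.image π, #(B.filter (fun x => π x = p)) :=
      card_eq_sum_card_fiberwise fun x hx => mem_image_of_mem π hx
    have : ∑ p ∈ B.image π, (#E + #(B.filter (fun x => π x = p))) ≤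
        ∑ p ∈ B.image π, (#(E + B.filter (fun x => π x = p)) + 1) := by
      refine sum_le_sum fun p hp => card_add_card_le_card_add hE ?_
      obtain ⟨x, hx, rfl⟩ := mem_image.mp hp
      exact ⟨x, mem_filter.mpr ⟨hx, rfl⟩⟩
    simp only [sum_add_distrib, sum_const, smul_eq_mul, mul_one, ← hB] at this
    omega
  · intro p _ p' _ hpp'
    refine disjoint_left.mpr fun z hz hz' => hpp' ?_
    obtain ⟨e, he, b, hb, rfl⟩ := mem_add.mp hz
    obtain ⟨e', he', b', hb', h⟩ := mem_add.mp hz'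
    have := congrArg π h
    rw [map_add, map_add, hq e he, hq e' he', (mem_filter.mp hb).2, (mem_filter.mp hb').2] at this
    exact (add_left_cancel this).symm

/-- Splitting off a face `E` of `E ∪ B`. -/
theorem card_add_of_face {E B X : Finset V} (f : V →ₗ[ℝ] ℝ) {c : ℝ} (hE : ∀ x ∈ E, f x = c)
    (hB : ∀ x ∈ B, c < f x) (hX : X ⊆ E + B) (hdisj : Disjoint X (B + B)) :
    #(B + B) + #(E + E) + #X ≤ #((E ∪ B) + (E ∪ B)) := by
  have hsub : (B + B) ∪ (E + E) ∪ X ⊆ (E ∪ B) + (E ∪ B) := by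
    refine union_subset (union_subset ?_ ?_) (hX.trans ?_)
    · exact add_subset_add subset_union_right subset_union_right
    · exact add_subset_add subset_union_left subset_union_left
    · exact add_subset_add subset_union_left subset_union_right
  have hBE : Disjoint (B + B) (E + E) := by
    refine disjoint_left.mpr fun z hz hz' => ?_
    obtain ⟨a, ha, b, hb, rfl⟩ := mem_add.mp hz
    obtain ⟨a', ha', b', hb', h⟩ := mem_add.mp hz'
    have := congrArg f h
    rw [map_add, map_add] at this
    linarith [hB a ha, hB b hb, hE a' ha', hE b' hb']
  have hEX : Disjoint (B + B ∪ (E + E)) X := by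
    refine disjoint_union_left.mpr ⟨hdisj.symm, disjoint_left.mpr fun z hz hz' => ?_⟩
    obtain ⟨a, ha, b, hb, rfl⟩ := mem_add.mp hz
    obtain ⟨a', ha', b', hb', h⟩ := mem_add.mp (hX hz')
    have := congrArg f h
    rw [map_add, map_add] at this
    linarith [hB b' hb', hE a ha, hE b hb, hE a' ha']
  rw [← card_union_of_disjoint hBE, ← card_union_of_disjoint hEX]
  exact card_le_card hsub

theorem mem_irreducibles {A : Finset V} {v w : V} : w ∈ irreducibles A v ↔
    w ∈ A ∧ w ≠ v ∧ ∀ a ∈ A, ∀ b ∈ A, a ≠ v → b ≠ v → a + b ≠ v + w := mem_filter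

theorem card_add_erase_vertex {A : Finset V} {v : V} (hv : IsVertex A v) :
    #(A.erase v + A.erase v) + 1 + #(irreducibles A v) ≤ #(A + A) := by
  obtain ⟨hvA, f, hf⟩ := hv
  have h := card_add_of_face (E := {v}) (B := A.erase v)
    (X := {v} + irreducibles A v) f (c := f v) (by simp)
    (fun x hx => hf x (mem_of_mem_erase hx) (ne_of_mem_erase hx))
    (add_subset_add_left fun w hw => by
      obtain ⟨h1, h2, -⟩ := mem_irreducibles.mp hw
      exact mem_erase.mpr ⟨h2, h1⟩) ?_
  · have hU : ({v} : Finset V) ∪ A.erase v = A := by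
      rw [← insert_eq, insert_erase hvA]
    rw [hU] at h
    simpa [singleton_add] using h
  · refine disjoint_left.mpr fun z hz hz' => ?_
    obtain ⟨v', hv', w, hw, rfl⟩ := mem_add.mp hz
    obtain ⟨a, ha, b, hb, h⟩ := mem_add.mp hz'
    rw [mem_singleton] at hv'
    subst hv'
    exact (mem_irreducibles.mp hw).2.2 a (mem_of_mem_erase ha) b (mem_of_mem_erase hb)
      (ne_of_mem_erase ha) (ne_of_mem_erase hb) h

theorem sub_mem_closure_irreducibles {A : Finset V} {v : V} (hv : IsVertex A v) {x : V}
    (hx : x ∈ A) : x - v ∈ AddSubmonoid.closure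
      (Set.range fun w : irreducibles A v => (w : V) - v) := by
  obtain ⟨hvA, f, hf⟩ := hv
  have key : ∀ n : ℕ, ∀ x ∈ A, #{z ∈ A | f z < f x} = n → x - v ∈ AddSubmonoid.closure
      (Set.range fun w : irreducibles A v => (w : V) - v) := by
    intro n
    induction n using Nat.strong_induction_on with
    | _ n ih =>
      intro x hx hn
      by_cases hxv : x = v
      · simp [hxv]
      by_cases hirr : x ∈ irreducibles A v
      · exact AddSubmonoid.subset_closure ⟨⟨x, hirr⟩, rfl⟩
      · simp only [mem_irreducibles, not_and, not_forall, not_not] at hirr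
        obtain ⟨a, ha, b, hb, hav, hbv, hab⟩ := hirr hx hxv
        have hlt : ∀ z ∈ A, f z < f x → #{y ∈ A | f y < f z} < n := by
          intro z hz hzx
          rw [← hn]
          refine card_lt_card ⟨fun y hy => ?_, fun h => ?_⟩
          · rw [mem_filter] at hy ⊢
            exact ⟨hy.1, hy.2.trans hzx⟩
          · exact lt_irrefl _ (mem_filter.mp (h (mem_filter.mpr ⟨hz, hzx⟩))).2
        have hfab := congrArg f hab
        rw [map_add, map_add] at hfab
        have e : x - v = (a - v) + (b - v) := by
          rw [show x = a + b - v by rw [hab]; abel]; abel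
        rw [e]
        exact add_mem
          (ih _ (hlt a ha (by linarith [hf b hb hbv])) a ha rfl)
          (ih _ (hlt b hb (by linarith [hf a ha hav])) b hb rfl)
  exact key _ x hx rfl

theorem exists_nat_combination {A : Finset V} {v : V} (hv : IsVertex A v) {x : V}
    (hx : x ∈ A) : ∃ N : irreducibles A v → ℕ, x = v + ∑ w, (N w : ℝ) • ((w : V) - v) := by
  obtain ⟨N, hN⟩ := AddSubmonoid.mem_closure_range_iff.mp (sub_mem_closure_irreducibles hv hx)
  refine ⟨N, ?_⟩
  rw [Finsupp.sum_fintype _ _ (by simp)] at hN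
  simp only [Nat.cast_smul_eq_nsmul]
  rw [← hN]; abel

theorem vectorSpan_le_span_irreducibles {A : Finset V} {v : V} (hv : IsVertex A v) :
    vectorSpan ℝ (A : Set V) ≤
      Submodule.span ℝ (Set.range fun w : irreducibles A v => (w : V) - v) := by
  rw [vectorSpan_eq_span_vsub_set_right ℝ (p := v) (mem_coe.mpr hv.1), Submodule.span_le]
  rintro _ ⟨x, hx, rfl⟩
  obtain ⟨N, hN⟩ := exists_nat_combination hv (mem_coe.mp hx)
  have e : x -ᵥ v = ∑ w : irreducibles A v, (N w : ℝ) • ((w : V) - v) := by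
    rw [vsub_eq_sub]
    nth_rewrite 1 [hN]
    abel
  simp only [SetLike.mem_coe]
  rw [e]
  exact Submodule.sum_mem _ fun w _ => Submodule.smul_mem _ _ (Submodule.subset_span ⟨w, rfl⟩)

theorem affRank_le_card_irreducibles {A : Finset V} {v : V} (hv : IsVertex A v) :
    affRank A ≤ #(irreducibles A v) := by
  have : FiniteDimensional ℝ (Submodule.span ℝ
    (Set.range fun w : irreducibles A v => (w : V) - v)) :=
    FiniteDimensional.span_of_finite ℝ (Set.finite_range _)
  refine (Submodule.finrank_mono (vectorSpan_le_span_irreducibles hv)).trans ?_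
  have h := finrank_range_le_card (R := ℝ) (fun w : irreducibles A v => (w : V) - v)
  rwa [Fintype.card_coe] at h

theorem vectorSpan_finite (A : Finset V) : FiniteDimensional ℝ (vectorSpan ℝ (A : Set V)) :=
  finiteDimensional_vectorSpan_of_finite ℝ A.finite_toSet

theorem affRank_mono {A B : Finset V} (h : A ⊆ B) : affRank A ≤ affRank B :=
  have := vectorSpan_finite B
  Submodule.finrank_mono (vectorSpan_mono ℝ (coe_subset.mpr h))

theorem affRank_add_one_le_card {A : Finset V} (hA : A.Nonempty) : affRank A + 1 ≤ #A := by
  obtain ⟨n, hn⟩ := Nat.exists_eq_succ_of_ne_zero (card_pos.mpr hA).ne'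
  have := finrank_vectorSpan_image_finset_le ℝ (id : V → V) A hn
  rw [image_id] at this
  rw [hn]
  exact Nat.succ_le_succ this

theorem affRank_le_erase_add_one {A : Finset V} {v : V} (hA : (A.erase v).Nonempty) :
    affRank A ≤ affRank (A.erase v) + 1 := by
  by_cases hv : v ∈ A
  · obtain ⟨p, hp⟩ := hA
    have hpA := mem_of_mem_erase hp
    have := vectorSpan_finite (A.erase v)
    have hle : vectorSpan ℝ (A : Set V) ≤
        vectorSpan ℝ (A.erase v : Set V) ⊔ Submodule.span ℝ {v - p} := by
      rw [vectorSpan_eq_span_vsub_set_right ℝ (p := p) (mem_coe.mpr hpA), Submodule.span_le]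
      rintro _ ⟨x, hx, rfl⟩
      by_cases hxv : x = v
      · subst hxv
        exact Submodule.mem_sup_right (Submodule.mem_span_singleton_self _)
      · exact Submodule.mem_sup_left (vsub_mem_vectorSpan ℝ
          (mem_coe.mpr (mem_erase.mpr ⟨hxv, hx⟩)) (mem_coe.mpr hp))
    refine (Submodule.finrank_mono hle).trans
      ((Submodule.finrank_add_le_finrank_add_finrank _ _).trans (Nat.add_le_add_left ?_ _))
    simpa using finrank_span_le_card (R := ℝ) ({v - p} : Set V)
  · rw [erase_eq_of_notMem hv]
    omega

theorem irreducibles_eq_erase {A : Finset V} {v : V} (hr : affRank (A.erase v) < affRank A) :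
    irreducibles A v = A.erase v := by
  ext w
  rw [mem_irreducibles, mem_erase]
  refine ⟨fun h => ⟨h.2.1, h.1⟩, fun ⟨hwv, hw⟩ => ⟨hw, hwv, fun a ha b hb hav hbv hab => ?_⟩⟩
  have := vectorSpan_finite (A.erase v)
  refine hr.not_ge (Submodule.finrank_mono ?_)
  have hmem : ∀ x ∈ A, x ≠ v → x ∈ ((A.erase v : Finset V) : Set V) := fun x hx hxv =>
    mem_coe.mpr (mem_erase.mpr ⟨hxv, hx⟩)
  have hvw : v - a ∈ vectorSpan ℝ ((A.erase v : Finset V) : Set V) := by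
    rw [show v - a = b -ᵥ w by rw [vsub_eq_sub, show v = a + b - w by rw [hab]; abel]; abel]
    exact vsub_mem_vectorSpan ℝ (hmem b hb hbv) (hmem w hw hwv)
  rw [vectorSpan_eq_span_vsub_set_right ℝ (p := a) (mem_coe.mpr ha), Submodule.span_le]
  rintro _ ⟨x, hx, rfl⟩
  by_cases hxv : x = v
  · subst hxv
    exact hvw
  · exact vsub_mem_vectorSpan ℝ (hmem x hx hxv) (hmem a ha hav)

/-- Removing a vertex without changing the dimension. -/
theorem doublingExcess_erase_of_affRank_eq {A : Finset V} {v : V} (hv : IsVertex A v)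
    (hr : affRank (A.erase v) = affRank A) :
    doublingExcess (A.erase v) + 2 * (#(irreducibles A v) - affRank A) ≤ doublingExcess A := by
  have h := card_add_erase_vertex hv
  have hc := card_erase_add_one hv.1
  unfold doublingExcess
  rw [hr, ← hc]
  push_cast
  zify at h
  linarith

/-- Removing the apex of a pyramid. -/
theorem doublingExcess_erase_of_affRank_lt {A : Finset V} {v : V} (hv : IsVertex A v)
    (hne : (A.erase v).Nonempty) (hr : affRank (A.erase v) < affRank A) :
    doublingExcess (A.erase v) ≤ doublingExcess A ∧ surplus (A.erase v) = surplus A := by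
  have h := card_add_erase_vertex hv
  rw [irreducibles_eq_erase hr] at h
  have hc := card_erase_add_one hv.1
  have hr' : affRank A = affRank (A.erase v) + 1 := by
    have := affRank_le_erase_add_one hne
    omega
  unfold doublingExcess surplus
  rw [hr', ← hc]
  push_cast
  zify at h
  constructor <;> nlinarith

/-- Freiman's lemma. -/
theorem doublingExcess_nonneg {A : Finset V} (hA : A.Nonempty) : 0 ≤ doublingExcess A := by
  induction hn : #A using Nat.strong_induction_on generalizing A with
  | _ n ih =>
    obtain ⟨v, hv⟩ := exists_isVertex hA
    have hc := card_erase_add_one hv.1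
    by_cases hne : (A.erase v).Nonempty
    · have h0 := ih _ (by omega) hne rfl
      rcases (affRank_mono (A.erase_subset v)).eq_or_lt with hr | hr
      · have := doublingExcess_erase_of_affRank_eq hv hr
        have := affRank_le_card_irreducibles hv
        omega
      · have := (doublingExcess_erase_of_affRank_lt hv hne hr).1
        omega
    · rw [not_nonempty_iff_eq_empty] at hne
      have h1 : #A = 1 := by rw [← hc, hne]; rfl
      obtain ⟨a, rfl⟩ := card_eq_one.mp h1
      have h0 : affRank {a} = 0 := by simpa using affRank_add_one_le_card hA
      simp [doublingExcess, h0]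

theorem exists_separating_of_card_le {Q : Finset V} (hQ : #Q ≤ affRank Q + 1) {p : V}
    (hp : p ∈ Q) : ∃ (l : V →ₗ[ℝ] ℝ) (c : ℝ), l p = c + 1 ∧ ∀ p' ∈ Q, p' ≠ p → l p' = c := by
  by_cases hne : (Q.erase p).Nonempty
  · obtain ⟨p₀, hp₀⟩ := hne
    have hp₀Q := mem_of_mem_erase hp₀
    have hlt : affRank (Q.erase p) < affRank Q := by
      have h1 := affRank_add_one_le_card ⟨p₀, hp₀⟩
      have h2 := card_erase_add_one hp
      omega
    have hnot : p - p₀ ∉ vectorSpan ℝ ((Q.erase p : Finset V) : Set V) := fun hmem => by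
      have := vectorSpan_finite (Q.erase p)
      refine hlt.not_ge (Submodule.finrank_mono ?_)
      rw [vectorSpan_eq_span_vsub_set_right ℝ (p := p₀) (mem_coe.mpr hp₀Q), Submodule.span_le]
      rintro _ ⟨x, hx, rfl⟩
      by_cases hxp : x = p
      · subst hxp
        exact hmem
      · exact vsub_mem_vectorSpan ℝ (mem_coe.mpr (mem_erase.mpr ⟨hxp, hx⟩)) (mem_coe.mpr hp₀)
    obtain ⟨l, hl, hker⟩ := Submodule.exists_le_ker_of_notMem hnot
    refine ⟨(l (p - p₀))⁻¹ • l, (l (p - p₀))⁻¹ * l p₀, ?_, fun p' hp' hpp' => ?_⟩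
    · have e : l p = l p₀ + l (p - p₀) := by rw [← map_add]; congr 1; abel
      rw [LinearMap.smul_apply, smul_eq_mul, e, mul_add, inv_mul_cancel₀ hl]
    · have h0 : l (p' - p₀) = 0 := hker (vsub_mem_vectorSpan ℝ
        (mem_coe.mpr (mem_erase.mpr ⟨hpp', hp'⟩)) (mem_coe.mpr hp₀))
      rw [map_sub, sub_eq_zero] at h0
      rw [LinearMap.smul_apply, smul_eq_mul, h0]
  · refine ⟨0, -1, by simp, fun p' hp' hpp' => ?_⟩
    exact absurd ⟨p', mem_erase.mpr ⟨hpp', hp'⟩⟩ hne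

theorem affRank_le_affRank_image_add_one (A : Finset V) (y : V) :
    affRank A ≤ affRank (A.image (lineClass y)) + 1 := by
  have hmap : vectorSpan ℝ ((A.image (lineClass y) : Finset _) : Set (V ⧸ Submodule.span ℝ {y})) =
      (vectorSpan ℝ (A : Set V)).map (lineClass y) := by
    rw [coe_image]
    exact (AffineMap.map_vectorSpan (lineClass y).toAffineMap).symm
  have := vectorSpan_finite A
  unfold affRank
  rw [hmap]
  have h := LinearMap.finrank_range_add_finrank_ker
    ((lineClass y).domRestrict (vectorSpan ℝ (A : Set V)))
  rw [LinearMap.range_domRestrict] at h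
  have hk : finrank ℝ (LinearMap.ker ((lineClass y).domRestrict (vectorSpan ℝ (A : Set V)))) ≤ 1 := by
    have h1 : finrank ℝ (Submodule.span ℝ {y}) ≤ 1 := by
      simpa using finrank_span_le_card (R := ℝ) ({y} : Set V)
    refine le_trans (LinearMap.finrank_le_finrank_of_injective
      (f := ((vectorSpan ℝ (A : Set V)).subtype.domRestrict _).codRestrict
        (Submodule.span ℝ {y}) ?_) ?_) h1
    · rintro ⟨x, hx⟩
      simpa [LinearMap.mem_ker] using hx
    · intro a b hab
      have h' := congrArg (Submodule.span ℝ {y}).subtype hab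
      exact Subtype.ext (Subtype.ext h')
  omega

theorem affRank_le_card_image {A : Finset V} (hA : A.Nonempty) (y : V) :
    affRank A ≤ #(A.image (lineClass y)) :=
  (affRank_le_affRank_image_add_one A y).trans (affRank_add_one_le_card (hA.image _))

theorem add_eq_add_of_card_le {Q : Finset V} (hQ : #Q ≤ affRank Q + 1) {a b c d : V}
    (ha : a ∈ Q) (hb : b ∈ Q) (hc : c ∈ Q) (hd : d ∈ Q) (h : a + b = c + d) :
    a = c ∧ b = d ∨ a = d ∧ b = c := by
  obtain ⟨l, e, hla, hl⟩ := exists_separating_of_card_le hQ ha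
  have hge : ∀ p ∈ Q, e ≤ l p := fun p hp => by
    by_cases hpa : p = a
    · rw [hpa, hla]; linarith
    · exact (hl p hp hpa).ge
  have hl' := congrArg l h
  rw [map_add, map_add, hla] at hl'
  by_cases hca : c = a
  · subst hca
    exact Or.inl ⟨rfl, add_left_cancel h⟩
  by_cases hda : d = a
  · subst hda
    rw [add_comm c] at h
    exact Or.inr ⟨rfl, add_left_cancel h⟩
  rw [hl c hc hca, hl d hd hda] at hl'
  linarith [hge b hb]

theorem eq_of_add_eq_add_of_notMem {Q : Finset V} (hQ : #Q ≤ affRank Q + 1) {q a b c a' b' c' : V}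
    (hq : q ∉ Q) (ha : a ∈ Q) (hb : b ∈ Q) (hc : c ∈ Q) (ha' : a' ∈ Q) (hb' : b' ∈ Q)
    (hc' : c' ∈ Q) (h : q + a = b + c) (h' : q + a' = b' + c') : a' = a := by
  by_contra hne
  obtain ⟨l, e, hla, hl⟩ := exists_separating_of_card_le hQ ha
  have hge : ∀ p ∈ Q, e ≤ l p := fun p hp => by
    by_cases hpa : p = a
    · rw [hpa, hla]; linarith
    · exact (hl p hp hpa).ge
  have hba : b ≠ a := fun hba => hq (by rw [hba, add_comm q] at h; rwa [add_left_cancel h])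
  have hca : c ≠ a := fun hca => hq (by rw [hca, add_comm b, add_comm q] at h; rwa [add_left_cancel h])
  have h1 := congrArg l h
  have h2 := congrArg l h'
  rw [map_add, map_add] at h1 h2
  linarith [hl b hb hba, hl c hc hca, hl a' ha' hne, hge b' hb', hge c' hc']

/-- Along every line of direction `y`, the set `A` is an arithmetic progression of step `y`. -/
def IsStep (A : Finset V) (y : V) : Prop :=
  y ≠ 0 ∧ ∀ x ∈ A, ∀ s : ℝ, 0 ≤ s → x + s • y ∈ A →
    (∃ n : ℕ, s = n) ∧ ∀ k : ℕ, (k : ℝ) ≤ s → x + (k : ℝ) • y ∈ A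

theorem mem_segment_add_smul {x y : V} {s t : ℝ} (hs : 0 ≤ s) (hst : s ≤ t) :
    x + s • y ∈ segment ℝ x (x + t • y) := by
  rcases hst.eq_or_lt with rfl | hst
  · exact right_mem_segment ℝ _ _
  · have ht : 0 < t := hs.trans_lt hst
    refine ⟨1 - s / t, s / t, ?_, by positivity, by ring, ?_⟩
    · rw [sub_nonneg, div_le_one ht]; exact hst.le
    · rw [smul_add, smul_smul, div_mul_cancel₀ _ ht.ne', ← add_assoc, ← add_smul]
      simp

theorem IsSegmentClosed.exists_isStep {Λ : AddSubgroup V} {A : Finset V}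
    (hA : IsSegmentClosed Λ A) {y₀ : V} (hy₀ : y₀ ≠ 0) :
    ∃ t : ℝ, t ≠ 0 ∧ IsStep A (t • y₀) := by
  obtain ⟨g, hg⟩ := Module.exists_dual_forall_apply_ne_zero (K := ℝ) (fun _ : Unit => y₀)
    (fun _ => hy₀)
  replace hg : g y₀ ≠ 0 := hg ()
  set D : Finset ℝ := ((A ×ˢ A).filter fun p => ∃ t : ℝ, 0 < t ∧ p.2 = p.1 + t • y₀).image
    (fun p => (g p.2 - g p.1) / g y₀) with hD
  have hmem : ∀ t : ℝ, t ∈ D ↔ 0 < t ∧ ∃ x ∈ A, x + t • y₀ ∈ A := by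
    intro t
    simp only [hD, mem_image, mem_filter, mem_product, Prod.exists]
    constructor
    · rintro ⟨a, b, ⟨⟨ha, hb⟩, s, hs, rfl⟩, rfl⟩
      have e : (g (a + s • y₀) - g a) / g y₀ = s := by
        rw [map_add, map_smul, smul_eq_mul]; field_simp; ring
      rw [e]
      exact ⟨hs, a, ha, hb⟩
    · rintro ⟨ht, x, hx, hx'⟩
      refine ⟨x, _, ⟨⟨hx, hx'⟩, t, ht, rfl⟩, ?_⟩
      rw [map_add, map_smul, smul_eq_mul]; field_simp; ring
  by_cases hne : D.Nonempty
  · obtain ⟨t, ht, hmin⟩ := D.exists_min_image id hne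
    obtain ⟨ht0, x₀, hx₀, hx₀'⟩ := (hmem t).mp ht
    have hyΛ : t • y₀ ∈ Λ := by
      have := Λ.sub_mem (hA.1 _ hx₀') (hA.1 _ hx₀)
      rwa [add_sub_cancel_left] at this
    have hk : ∀ x ∈ A, ∀ s : ℝ, x + s • t • y₀ ∈ A → ∀ k : ℕ, (k : ℝ) ≤ s →
        x + (k : ℝ) • t • y₀ ∈ A := fun x hx s hxs k hks => by
      refine hA.2 x hx _ hxs _ ?_ (mem_segment_add_smul k.cast_nonneg hks)
      rw [Nat.cast_smul_eq_nsmul]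
      exact Λ.add_mem (hA.1 x hx) (Λ.nsmul_mem hyΛ k)
    refine ⟨t, ht0.ne', smul_ne_zero ht0.ne' hy₀, fun x hx s hs hxs => ⟨⟨⌊s⌋₊, ?_⟩, hk x hx s hxs⟩⟩
    by_contra hne'
    have hfl : (⌊s⌋₊ : ℝ) < s := lt_of_le_of_ne (Nat.floor_le hs) (Ne.symm hne')
    have hD' : (s - ⌊s⌋₊) * t ∈ D := (hmem _).mpr ⟨mul_pos (sub_pos.mpr hfl) ht0, _,
      hk x hx s hxs ⌊s⌋₊ hfl.le, by
        convert hxs using 1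
        rw [smul_smul, smul_smul, add_assoc, ← add_smul]
        congr 2; ring⟩
    have h1 : t ≤ (s - ⌊s⌋₊) * t := hmin _ hD'
    have h2 := Nat.lt_floor_add_one s
    nlinarith
  · refine ⟨1, one_ne_zero, by rwa [one_smul], fun x hx s hs hxs => ?_⟩
    have hs0 : s = 0 := by
      by_contra hs'
      refine hne ⟨s, (hmem s).mpr ⟨lt_of_le_of_ne hs (Ne.symm hs'), x, hx, by rwa [one_smul] at hxs⟩⟩
    subst hs0
    refine ⟨⟨0, by simp⟩, fun k hk => ?_⟩
    have : k = 0 := by exact_mod_cast le_antisymm hk k.cast_nonneg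
    subst this
    simpa using hx

theorem card_image_lineClass_smul (A : Finset V) (y : V) {t : ℝ} (ht : t ≠ 0) :
    #(A.image (lineClass (t • y))) = #(A.image (lineClass y)) := by
  have key : ∀ S : Submodule ℝ V, S = Submodule.span ℝ {y} →
      #(A.image S.mkQ) = #(A.image (lineClass y)) := by
    rintro _ rfl
    rfl
  exact key _ (Submodule.span_singleton_smul_eq (IsUnit.mk0 t ht) y)

theorem CoveredByLines.exists_isStep {Λ : AddSubgroup V} {A : Finset V}
    (hA : IsSegmentClosed Λ A) (h : CoveredByLines A) :
    ∃ y, IsStep A y ∧ #(A.image (lineClass y)) ≤ affRank A := by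
  obtain ⟨y₀, hy₀, hc⟩ := h
  obtain ⟨t, ht, hstep⟩ := hA.exists_isStep hy₀
  exact ⟨_, hstep, by rwa [card_image_lineClass_smul A y₀ ht]⟩

/-- The points of `A` on the line `p`. -/
noncomputable def lineFiber (A : Finset V) (y : V) (p : V ⧸ Submodule.span ℝ {y}) : Finset V :=
  {x ∈ A | lineClass y x = p}

theorem mem_lineFiber {A : Finset V} {y : V} {p : V ⧸ Submodule.span ℝ {y}} {x : V} :
    x ∈ lineFiber A y p ↔ x ∈ A ∧ lineClass y x = p := mem_filter

theorem lineFiber_nonempty {A : Finset V} {y : V} {p : V ⧸ Submodule.span ℝ {y}}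
    (hp : p ∈ A.image (lineClass y)) : (lineFiber A y p).Nonempty := by
  obtain ⟨x, hx, rfl⟩ := mem_image.mp hp
  exact ⟨x, mem_lineFiber.mpr ⟨hx, rfl⟩⟩

theorem sum_card_lineFiber (A : Finset V) (y : V) :
    ∑ p ∈ A.image (lineClass y), #(lineFiber A y p) = #A :=
  (card_eq_sum_card_fiberwise fun _ hx => mem_image_of_mem _ hx).symm

theorem smul_injective_add {b y : V} (hy : y ≠ 0) :
    Function.Injective fun i : ℕ => b + (i : ℝ) • y := fun i j h => by
  have h' : ((i : ℝ) - j) • y = 0 := by rw [sub_smul, sub_eq_zero]; exact add_left_cancel h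
  rcases smul_eq_zero.mp h' with h' | h'
  · exact_mod_cast sub_eq_zero.mp h'
  · exact absurd h' hy

theorem IsStep.lineFiber_eq {A : Finset V} {y : V} (h : IsStep A y) {p : V ⧸ Submodule.span ℝ {y}}
    (hp : p ∈ A.image (lineClass y)) : ∃ b,
    lineFiber A y p = (range #(lineFiber A y p)).image fun i : ℕ => b + (i : ℝ) • y := by
  obtain ⟨hy, hA⟩ := h
  obtain ⟨g, hg⟩ := Module.exists_dual_forall_apply_ne_zero (K := ℝ) (fun _ : Unit => y)
    (fun _ => hy)
  replace hg : g y ≠ 0 := hg ()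
  obtain ⟨b, hb, hmin⟩ := (lineFiber A y p).exists_min_image (fun x => g x / g y)
    (lineFiber_nonempty hp)
  obtain ⟨hbA, hbp⟩ := mem_lineFiber.mp hb
  have hform : ∀ x ∈ lineFiber A y p, ∃ n : ℕ, x = b + (n : ℝ) • y := by
    intro x hx
    obtain ⟨hxA, hxp⟩ := mem_lineFiber.mp hx
    obtain ⟨s, rfl⟩ := lineClass_eq_iff.mp (hxp.trans hbp.symm)
    have hs : 0 ≤ s := by
      have h0 := hmin _ hx
      rw [map_add, map_smul, smul_eq_mul, add_div, mul_div_cancel_right₀ _ hg] at h0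
      linarith
    obtain ⟨n, rfl⟩ := (hA b hbA s hs hxA).1
    exact ⟨n, rfl⟩
  obtain ⟨x, hx, hmax⟩ := (lineFiber A y p).exists_max_image (fun x => g x / g y)
    (lineFiber_nonempty hp)
  obtain ⟨n, rfl⟩ := hform x hx
  have hF : lineFiber A y p = (range (n + 1)).image fun i : ℕ => b + (i : ℝ) • y := by
    ext z
    simp only [mem_image, mem_range]
    constructor
    · intro hz
      obtain ⟨k, rfl⟩ := hform z hz
      refine ⟨k, ?_, rfl⟩
      have h0 := hmax _ hz
      simp only [map_add, map_smul, smul_eq_mul, add_div, mul_div_cancel_right₀ _ hg] at h0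
      have h1 : (k : ℝ) ≤ n := by linarith
      exact Nat.lt_succ_of_le (by exact_mod_cast h1)
    · rintro ⟨k, hk, rfl⟩
      refine mem_lineFiber.mpr ⟨(hA b hbA n n.cast_nonneg (mem_lineFiber.mp hx).1).2 k
        (by exact_mod_cast Nat.le_of_lt_succ hk), ?_⟩
      rw [← hbp]
      exact lineClass_eq_iff.mpr ⟨k, rfl⟩
  refine ⟨b, ?_⟩
  nth_rewrite 2 [hF]
  rw [card_image_of_injective _ (smul_injective_add hy), card_range, ← hF]

theorem IsStep.card_add_lineFiber {A : Finset V} {y : V} (h : IsStep A y)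
    {p q : V ⧸ Submodule.span ℝ {y}} (hp : p ∈ A.image (lineClass y))
    (hq : q ∈ A.image (lineClass y)) :
    #(lineFiber A y p + lineFiber A y q) + 1 ≤ #(lineFiber A y p) + #(lineFiber A y q) := by
  obtain ⟨b, hb⟩ := h.lineFiber_eq hp
  obtain ⟨b', hb'⟩ := h.lineFiber_eq hq
  have hp0 := card_pos.mpr (lineFiber_nonempty hp)
  have hq0 := card_pos.mpr (lineFiber_nonempty hq)
  have hsub : lineFiber A y p + lineFiber A y q ⊆
      (range (#(lineFiber A y p) + #(lineFiber A y q) - 1)).image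
        fun i : ℕ => b + b' + (i : ℝ) • y := by
    intro z hz
    obtain ⟨x, hx, x', hx', rfl⟩ := mem_add.mp hz
    rw [hb] at hx
    rw [hb'] at hx'
    obtain ⟨i, hi, rfl⟩ := mem_image.mp hx
    obtain ⟨j, hj, rfl⟩ := mem_image.mp hx'
    rw [mem_range] at hi hj
    refine mem_image.mpr ⟨i + j, mem_range.mpr (by omega), ?_⟩
    push_cast
    rw [add_smul]; abel
  have := (card_le_card hsub).trans card_image_le
  rw [card_range] at this
  omega

theorem card_lineFiber_add_card_le {A : Finset V} {y : V} {Q : Finset (V ⧸ Submodule.span ℝ {y})}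
    (hQ : Q ⊆ A.image (lineClass y)) {p : V ⧸ Submodule.span ℝ {y}} (hp : p ∈ Q) :
    #(lineFiber A y p) + #Q ≤ ∑ p' ∈ Q, #(lineFiber A y p') + 1 := by
  rw [← add_sum_erase _ _ hp, ← card_erase_add_one hp]
  have : #(Q.erase p) ≤ ∑ p' ∈ Q.erase p, #(lineFiber A y p') := by
    rw [card_eq_sum_ones]
    exact sum_le_sum fun p' hp' => card_pos.mpr (lineFiber_nonempty (hQ (mem_of_mem_erase hp')))
  omega

theorem card_lineFiber_add_card_le' {A : Finset V} {y : V} {Q : Finset (V ⧸ Submodule.span ℝ {y})}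
    (hQ : Q ⊆ A.image (lineClass y)) {p p' : V ⧸ Submodule.span ℝ {y}} (hp : p ∈ Q) (hp' : p' ∈ Q)
    (hpp' : p ≠ p') :
    #(lineFiber A y p) + #(lineFiber A y p') + #Q ≤ ∑ p ∈ Q, #(lineFiber A y p) + 2 := by
  have h := card_lineFiber_add_card_le ((erase_subset p Q).trans hQ)
    (mem_erase.mpr ⟨hpp'.symm, hp'⟩)
  rw [← add_sum_erase _ _ hp, ← card_erase_add_one hp]
  omega

/-- A set which is not covered by few parallel lines, although it becomes so upon removal of a
face contained in one further line of the same direction. -/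
theorem two_mul_surplus_lt_of_split {A E : Finset V} {y : V} (hstep : IsStep A y)
    (hE : E.Nonempty) (hA : A.Nonempty) {q : V ⧸ Submodule.span ℝ {y}}
    (hEq : ∀ x ∈ E, lineClass y x = q) (hq : q ∉ A.image (lineClass y))
    (hcov : #(A.image (lineClass y)) ≤ affRank A) (hr : affRank (E ∪ A) = affRank A)
    (f : V →ₗ[ℝ] ℝ) {c : ℝ} (hfE : ∀ x ∈ E, f x = c) (hfA : ∀ x ∈ A, c < f x)
    (hrel : #E = 1 ∨ ∃ i ∈ A.image (lineClass y), ∃ j ∈ A.image (lineClass y),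
      ∃ k ∈ A.image (lineClass y), q + i = j + k) :
    2 * surplus (E ∪ A) < 3 * doublingExcess (E ∪ A) + 8 := by
  set Q := A.image (lineClass y) with hQdef
  have hmemQ : ∀ x ∈ A, lineClass y x ∈ Q := fun x hx => mem_image_of_mem _ hx
  have hQr : #Q = affRank A := le_antisymm hcov (affRank_le_card_image hA y)
  have hQind : #Q ≤ affRank Q + 1 := hcov.trans (affRank_le_affRank_image_add_one A y)
  have hdisj : Disjoint E A := disjoint_left.mpr fun x hx hx' => by
    linarith [hfE x hx, hfA x hx']
  have hcard : #(E ∪ A) = #E + #A := card_union_of_disjoint hdisj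
  have hexc := doublingExcess_nonneg hA
  have hQA : #Q ≤ #A := card_image_le
  unfold surplus doublingExcess at *
  rw [hr, hcard]
  by_cases hex : ∃ i ∈ Q, ∃ j ∈ Q, ∃ k ∈ Q, q + i = j + k
  · obtain ⟨i, hi, j, hj, k, hk, hijk⟩ := hex
    have hji : j ≠ i := fun h => hq (by
      rw [h, add_comm i] at hijk; rwa [add_right_cancel hijk])
    have hki : k ≠ i := fun h => hq (by rw [h] at hijk; rwa [add_right_cancel hijk])
    set A₁ := A.filter fun x => lineClass y x ≠ i with hA₁
    set X₁ := E + A₁ with hX₁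
    set X₂ := (E + lineFiber A y i) \ (lineFiber A y j + lineFiber A y k) with hX₂
    have himg : A₁.image (lineClass y) = Q.erase i := by
      ext p
      simp only [hA₁, hQdef, mem_image, mem_filter, mem_erase]
      constructor
      · rintro ⟨x, ⟨hx, hxi⟩, rfl⟩
        exact ⟨hxi, x, hx, rfl⟩
      · rintro ⟨hpi, x, hx, rfl⟩
        exact ⟨x, ⟨hx, hpi⟩, rfl⟩
    have hfib : ∀ p ∈ Q.erase i, lineFiber A₁ y p = lineFiber A y p := fun p hp => by
      ext x
      rw [mem_lineFiber, mem_lineFiber, mem_filter]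
      refine ⟨fun h => ⟨h.1.1, h.2⟩, fun h => ⟨⟨h.1, ?_⟩, h.2⟩⟩
      rw [h.2]; exact ne_of_mem_erase hp
    have hS : ∑ p ∈ Q.erase i, #(lineFiber A y p) = #A₁ := by
      rw [← sum_card_lineFiber A₁ y, himg]
      exact sum_congr rfl fun p hp => by rw [hfib p hp]
    have hN : #A = #A₁ + #(lineFiber A y i) := by
      rw [← hS, ← sum_card_lineFiber A y, ← add_sum_erase _ _ hi, add_comm]
    have hface := card_add_of_face (E := E) (B := A) (X := X₁ ∪ X₂) f hfE hfA
      (union_subset (add_subset_add_left (filter_subset _ _))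
        (sdiff_subset.trans (add_subset_add_left (filter_subset _ _)))) (by
      refine disjoint_left.mpr fun z hz hz' => ?_
      obtain ⟨b, hb, b', hb', rfl⟩ := mem_add.mp hz'
      rcases mem_union.mp hz with hz | hz
      · obtain ⟨e, he, a, ha, h⟩ := mem_add.mp hz
        obtain ⟨ha, hai⟩ := mem_filter.mp ha
        have hcl := congrArg (lineClass y) h
        rw [map_add, map_add, hEq e he] at hcl
        exact hai (eq_of_add_eq_add_of_notMem hQind hq hi hj hk (hmemQ a ha) (hmemQ b hb)
          (hmemQ b' hb') hijk hcl)
      · obtain ⟨hz, hzn⟩ := mem_sdiff.mp hz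
        obtain ⟨e, he, a, ha, h⟩ := mem_add.mp hz
        have hcl := congrArg (lineClass y) h
        rw [map_add, map_add, hEq e he, (mem_lineFiber.mp ha).2, hijk] at hcl
        rcases add_eq_add_of_card_le hQind hj hk (hmemQ b hb) (hmemQ b' hb') hcl with
          ⟨h1, h2⟩ | ⟨h1, h2⟩
        · exact hzn (add_mem_add (mem_lineFiber.mpr ⟨hb, h1.symm⟩)
            (mem_lineFiber.mpr ⟨hb', h2.symm⟩))
        · rw [add_comm b] at hzn
          exact hzn (add_mem_add (mem_lineFiber.mpr ⟨hb', h1.symm⟩)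
            (mem_lineFiber.mpr ⟨hb, h2.symm⟩)))
    have hX : #(X₁ ∪ X₂) = #X₁ + #X₂ := card_union_of_disjoint (by
      refine disjoint_left.mpr fun z hz hz' => ?_
      obtain ⟨e, he, a, ha, rfl⟩ := mem_add.mp hz
      obtain ⟨e', he', a', ha', h⟩ := mem_add.mp (mem_sdiff.mp hz').1
      have hcl := congrArg (lineClass y) h
      rw [map_add, map_add, hEq e he, hEq e' he', (mem_lineFiber.mp ha').2] at hcl
      exact (mem_filter.mp ha).2 (add_left_cancel hcl).symm)
    have hX₁c := card_add_of_const (lineClass y).toAddMonoidHom A₁ hE hEq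
    rw [show A₁.image (lineClass y).toAddMonoidHom = Q.erase i from himg] at hX₁c
    have hX₂c : #(E + lineFiber A y i) ≤ #X₂ + #(lineFiber A y j + lineFiber A y k) := by
      have : _ ≤ #X₂ := le_card_sdiff (lineFiber A y j + lineFiber A y k) (E + lineFiber A y i)
      omega
    have hEi := card_add_card_le_card_add hE (lineFiber_nonempty hi)
    have hEE := card_add_card_le_card_add hE hE
    have hjk := hstep.card_add_lineFiber hj hk
    have hQe := card_erase_add_one hi
    have hE0 := card_pos.mpr hE
    have hj' : j ∈ Q.erase i := mem_erase.mpr ⟨hji, hj⟩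
    have hk' : k ∈ Q.erase i := mem_erase.mpr ⟨hki, hk⟩
    have hj0 := card_pos.mpr (lineFiber_nonempty hj)
    have hk0 := card_pos.mpr (lineFiber_nonempty hk)
    have hSb : (#(lineFiber A y j) + #(lineFiber A y k) + 1 : ℤ) ≤ 2 * #A₁ - 2 * #Q + 5 := by
      by_cases hjk' : j = k
      · have := card_lineFiber_add_card_le (A := A) (erase_subset i Q) hj'
        rw [← hjk']
        omega
      · have := card_lineFiber_add_card_le' (A := A) (erase_subset i Q) hj' hk' hjk'
        omega
    rw [← hQr] at hexc ⊢
    rw [hN] at hexc ⊢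
    rw [hX] at hface
    obtain ⟨r', hr'⟩ : ∃ r' : ℕ, #(Q.erase i) = r' := ⟨_, rfl⟩
    rw [hr'] at hX₁c hQe
    rw [← hQe] at hexc hSb ⊢
    rw [← hX₁] at hX₁c
    clear_value A₁ X₁ X₂
    push_cast at *
    zify at *
    nlinarith
  · have hE1 : #E = 1 := hrel.resolve_right hex
    push Not at hex
    have hface := card_add_of_face (E := E) (B := A) (X := E + A) f hfE hfA subset_rfl (by
      refine disjoint_left.mpr fun z hz hz' => ?_
      obtain ⟨b, hb, b', hb', rfl⟩ := mem_add.mp hz'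
      obtain ⟨e, he, a, ha, h⟩ := mem_add.mp hz
      have hcl := congrArg (lineClass y) h
      rw [map_add, map_add, hEq e he] at hcl
      exact hex _ (hmemQ a ha) _ (hmemQ b hb) _ (hmemQ b' hb') hcl)
    have h1 := card_add_card_le_card_add hE hA
    have h2 := card_add_card_le_card_add hE hE
    rw [hE1] at h1 h2 ⊢
    rw [← hQr] at hexc ⊢
    zify at *
    nlinarith

/-- Coordinates on `A` with origin a vertex `v` at which the irreducibles are linearly
independent: `u` lists the irreducible differences, `c` is a dual system of functionals, and
`N` gives the coordinates of the points of `A`. -/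
structure IsChart (A : Finset V) (v : V) {ι : Type*} [Fintype ι] (u : ι → V)
    (c : ι → V →ₗ[ℝ] ℝ) (N : V → ι → ℕ) : Prop where
  card_eq : Fintype.card ι = affRank A
  origin_mem : v ∈ A
  mem : ∀ i, v + u i ∈ A
  dual : ∀ i j, c i (u j) = if i = j then 1 else 0
  eq_sum : ∀ x ∈ A, x = v + ∑ i, (N x i : ℝ) • u i
  exists_add_eq : ∀ x ∈ A, x ≠ v → (∀ i, x ≠ v + u i) →
    ∃ a ∈ A, ∃ b ∈ A, a ≠ v ∧ b ≠ v ∧ a + b = v + x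

theorem LinearIndependent.exists_dual {ι : Type*} [Fintype ι] {u : ι → V}
    (hu : LinearIndependent ℝ u) :
    ∃ c : ι → V →ₗ[ℝ] ℝ, ∀ i j, c i (u j) = if i = j then 1 else 0 := by
  choose c hc using fun i => LinearMap.exists_extend ((Basis.span hu).coord i)
  refine ⟨c, fun i j => ?_⟩
  have h1 := LinearMap.congr_fun (hc i) (Basis.span hu j)
  rw [LinearMap.comp_apply, Basis.coord_apply, Basis.repr_self, Finsupp.single_apply,
    Submodule.subtype_apply, Basis.span_apply] at h1
  simpa only [eq_comm] using h1

theorem exists_isChart {A : Finset V} {v : V} (hv : IsVertex A v)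
    (hcard : #(irreducibles A v) = affRank A) :
    ∃ c N, IsChart A v (fun w : irreducibles A v => (w : V) - v) c N := by
  have hli : LinearIndependent ℝ fun w : irreducibles A v => (w : V) - v := by
    rw [linearIndependent_iff_card_le_finrank_span, Fintype.card_coe, hcard]
    have : FiniteDimensional ℝ (Submodule.span ℝ
      (Set.range fun w : irreducibles A v => (w : V) - v)) :=
      FiniteDimensional.span_of_finite ℝ (Set.finite_range _)
    exact Submodule.finrank_mono (vectorSpan_le_span_irreducibles hv)
  obtain ⟨c, hc⟩ := hli.exists_dual
  choose! N hN using fun x (hx : x ∈ A) => exists_nat_combination hv hx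
  refine ⟨c, N, ⟨by rw [Fintype.card_coe, hcard], hv.1, fun w => ?_, hc, hN,
    fun x hx hxv hxu => ?_⟩⟩
  · rw [add_sub_cancel]
    exact (mem_irreducibles.mp w.2).1
  · by_contra hcon
    push Not at hcon
    refine hxu ⟨x, mem_irreducibles.mpr ⟨hx, hxv, fun a ha b hb hav hbv => ?_⟩⟩ (by simp)
    exact hcon a ha b hb hav hbv

theorem IsSegmentClosed.add_smul_mem {Λ : AddSubgroup V} {A : Finset V}
    (hA : IsSegmentClosed Λ A) {x y z : V} (hyΛ : y ∈ Λ) {m k : ℕ} (hkm : k ≤ m) (hx : x ∈ A)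
    (hz : z ∈ A) (h : z = x + (m : ℝ) • y) : x + (k : ℝ) • y ∈ A := by
  refine hA.2 x hx z hz _ ?_ ?_
  · rw [Nat.cast_smul_eq_nsmul]
    exact Λ.add_mem (hA.1 x hx) (Λ.nsmul_mem hyΛ k)
  · rw [h]
    exact mem_segment_add_smul k.cast_nonneg (by exact_mod_cast hkm)

namespace IsChart

variable {Λ : AddSubgroup V} {A : Finset V} {v : V} {ι : Type*} [Fintype ι] {u : ι → V}
  {c : ι → V →ₗ[ℝ] ℝ} {N : V → ι → ℕ}

theorem apply_eq (h : IsChart A v u c N) {x : V} (hx : x ∈ A) (i : ι) :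
    c i x = c i v + N x i := by
  conv_lhs => rw [h.eq_sum x hx]
  rw [map_add, map_sum]
  simp [h.dual]

theorem add_eq (h : IsChart A v u c N) {a b x w : V} (ha : a ∈ A) (hb : b ∈ A) (hx : x ∈ A)
    (hw : w ∈ A) (hab : a + b = x + w) (i : ι) : N a i + N b i = N x i + N w i := by
  have h1 := congrArg (c i) hab
  rw [map_add, map_add, h.apply_eq ha, h.apply_eq hb, h.apply_eq hx, h.apply_eq hw] at h1
  have : (N a i + N b i : ℝ) = N x i + N w i := by linarith
  exact_mod_cast this

theorem ext (h : IsChart A v u c N) {a b : V} (ha : a ∈ A) (hb : b ∈ A)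
    (hab : ∀ i, N a i = N b i) : a = b := by
  rw [h.eq_sum a ha, h.eq_sum b hb]
  simp [hab]

theorem coord_origin (h : IsChart A v u c N) (i : ι) : N v i = 0 := by
  have := h.apply_eq h.origin_mem i
  simpa using this

theorem coord_add_smul (h : IsChart A v u c N) {x : V} {o : ι} {k : ℝ} (hx : x ∈ A)
    (hxk : x + k • u o ∈ A) (i : ι) : (N (x + k • u o) i : ℝ) = N x i + if i = o then k else 0 := by
  have h1 := h.apply_eq hxk i
  rw [map_add, map_smul, h.dual, h.apply_eq hx] at h1
  simp only [smul_eq_mul, mul_ite, mul_one, mul_zero] at h1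
  linarith

theorem coord_add_nat_smul (h : IsChart A v u c N) {x : V} {o : ι} {k : ℕ} (hx : x ∈ A)
    (hxk : x + (k : ℝ) • u o ∈ A) (i : ι) :
    N (x + (k : ℝ) • u o) i = N x i + if i = o then k else 0 := by
  have := h.coord_add_smul hx hxk i
  split_ifs at * <;> exact_mod_cast this

theorem coord_add (h : IsChart A v u c N) (o i : ι) : N (v + u o) i = if i = o then 1 else 0 := by
  have := h.coord_add_smul (k := 1) (o := o) h.origin_mem (by rw [one_smul]; exact h.mem o) i
  rw [one_smul, h.coord_origin] at this
  split_ifs at * <;> simpa using this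

theorem ne_zero (h : IsChart A v u c N) (o : ι) : u o ≠ 0 := fun h0 => by
  simpa [h0] using h.dual o o

theorem direction_mem (h : IsChart A v u c N) (hA : IsSegmentClosed Λ A) (o : ι) : u o ∈ Λ := by
  simpa using Λ.sub_mem (hA.1 _ (h.mem o)) (hA.1 _ h.origin_mem)

theorem lineClass_eq (h : IsChart A v u c N) {x z : V} (o : ι) (hx : x ∈ A) (hz : z ∈ A) :
    lineClass (u o) x = lineClass (u o) z ↔ ∀ i, i ≠ o → N x i = N z i := by
  rw [lineClass_eq_iff]
  constructor
  · rintro ⟨t, rfl⟩ i hi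
    have := h.coord_add_smul hz hx i
    rw [if_neg hi, add_zero] at this
    exact_mod_cast this
  · intro hi
    refine ⟨(N x o : ℝ) - N z o, ?_⟩
    calc x = v + ∑ i, (N x i : ℝ) • u i := h.eq_sum x hx
      _ = v + ∑ i, (N z i : ℝ) • u i + ((N x o : ℝ) - N z o) • u o := by
        rw [← add_sum_erase _ _ (mem_univ o),
          ← add_sum_erase _ (fun i => (N z i : ℝ) • u i) (mem_univ o),
          sum_congr rfl fun i hi' => by rw [hi i (ne_of_mem_erase hi')], sub_smul]
        abel
      _ = z + ((N x o : ℝ) - N z o) • u o := by rw [← h.eq_sum z hz]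

theorem isStep (h : IsChart A v u c N) (hA : IsSegmentClosed Λ A) (o : ι) : IsStep A (u o) := by
  refine ⟨h.ne_zero o, fun x hx s hs hxs => ?_⟩
  have h1 := h.coord_add_smul hx hxs o
  rw [if_pos rfl] at h1
  have hle : N x o ≤ N (x + s • u o) o := by
    have : (N x o : ℝ) ≤ N (x + s • u o) o := by linarith
    exact_mod_cast this
  have hs' : s = (N (x + s • u o) o - N x o : ℕ) := by
    rw [Nat.cast_sub hle]; linarith
  refine ⟨⟨_, hs'⟩, fun k hk => hA.add_smul_mem (h.direction_mem hA o) (k := k)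
    (m := N (x + s • u o) o - N x o) ?_ hx hxs (by rw [← hs'])⟩
  rw [hs'] at hk
  exact_mod_cast hk

theorem add_smul_mem_iff (h : IsChart A v u c N) (hA : IsSegmentClosed Λ A) {o : ι} {x : V}
    (hx : x ∈ A) (hxo : N x o = 0) (k : ℕ) :
    x + (k : ℝ) • u o ∈ A ↔ k < #(lineFiber A (u o) (lineClass (u o) x)) := by
  obtain ⟨b, hb⟩ := (h.isStep hA o).lineFiber_eq (mem_image_of_mem (lineClass (u o)) hx)
  have hxm : x ∈ lineFiber A (u o) (lineClass (u o) x) := mem_lineFiber.mpr ⟨hx, rfl⟩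
  have hpos := card_pos.mpr ⟨x, hxm⟩
  have hbA : b ∈ A := by
    have : b ∈ lineFiber A (u o) (lineClass (u o) x) := by
      rw [hb]
      exact mem_image.mpr ⟨0, mem_range.mpr hpos, by simp⟩
    exact (mem_lineFiber.mp this).1
  have hbx : b = x := by
    have hxm' := hxm
    rw [hb] at hxm'
    obtain ⟨i, -, hi⟩ := mem_image.mp hxm'
    have h1 := h.coord_add_nat_smul (k := i) (o := o) hbA (by simpa [hi] using hx) o
    rw [hi, hxo, if_pos rfl] at h1
    have : i = 0 := by omega
    rw [← hi, this]; simp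
  subst hbx
  constructor
  · intro hk
    have : b + (k : ℝ) • u o ∈ lineFiber A (u o) (lineClass (u o) b) :=
      mem_lineFiber.mpr ⟨hk, lineClass_eq_iff.mpr ⟨_, rfl⟩⟩
    rw [hb] at this
    obtain ⟨i, hi, hik⟩ := mem_image.mp this
    rw [← smul_injective_add (h.ne_zero o) hik]
    exact mem_range.mp hi
  · intro hk
    have : b + (k : ℝ) • u o ∈ lineFiber A (u o) (lineClass (u o) b) := by
      rw [hb]
      exact mem_image.mpr ⟨k, mem_range.mpr hk, rfl⟩
    exact (mem_lineFiber.mp this).1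

theorem coveredByLines (h : IsChart A v u c N) (o : ι)
    (hsum : ∀ x ∈ A, ∑ i ∈ univ.erase o, N x i ≤ 1) : CoveredByLines A := by
  refine ⟨u o, h.ne_zero o, ?_⟩
  have hsub : A.image (lineClass (u o)) ⊆ insert (lineClass (u o) v)
      ((univ.erase o).image fun i => lineClass (u o) (v + u i)) := by
    intro p hp
    obtain ⟨x, hx, rfl⟩ := mem_image.mp hp
    rw [mem_insert]
    by_cases h0 : ∀ i, i ≠ o → N x i = 0
    · left
      exact (h.lineClass_eq o hx h.origin_mem).mpr fun i hi => by rw [h0 i hi, h.coord_origin]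
    · right
      push Not at h0
      obtain ⟨j, hj, hj0⟩ := h0
      have hs := hsum x hx
      have hj' : j ∈ univ.erase o := mem_erase.mpr ⟨hj, mem_univ _⟩
      rw [← add_sum_erase _ _ hj'] at hs
      refine mem_image.mpr ⟨j, hj', ((h.lineClass_eq o hx (h.mem j)).mpr fun i hi => ?_).symm⟩
      rw [h.coord_add]
      split_ifs with hij
      · subst hij; omega
      · have := single_le_sum (f := fun i => N x i) (fun _ _ => Nat.zero_le _)
          (mem_erase.mpr ⟨hij, mem_erase.mpr ⟨hi, mem_univ i⟩⟩ : i ∈ (univ.erase o).erase j)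
        omega
  have h1 := (card_le_card hsub).trans (card_insert_le _ _)
  have h2 : #((univ.erase o).image fun i => lineClass (u o) (v + u i)) ≤ #(univ.erase o) :=
    card_image_le
  have h3 := card_erase_add_one (mem_univ o)
  rw [card_univ, h.card_eq] at h3
  omega

theorem card_le_choose (h : IsChart A v u c N) {m : ℕ} (hsum : ∀ x ∈ A, ∑ i, N x i ≤ m) :
    #A ≤ (affRank A + m).choose m := by
  have h1 := card_finsuppAntidiag_nat_eq_choose (s := (univ : Finset (Option ι))) m
  rw [card_univ, Fintype.card_option, h.card_eq, add_right_comm, Nat.add_sub_cancel] at h1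
  rw [← h1]
  refine card_le_card_of_injOn
    (fun x => Finsupp.equivFunOnFinite.symm fun i => i.elim (m - ∑ i, N x i) (N x)) ?_ ?_
  · intro x hx
    have := hsum x hx
    simp [mem_finsuppAntidiag, Fintype.sum_option]
    omega
  · intro x hx z hz hxz
    refine h.ext hx hz fun i => ?_
    simpa using DFunLike.congr_fun hxz (some i)

theorem eq_add_smul (h : IsChart A v u c N) {o : ι} {x z : V} (hx : x ∈ A) (hz : z ∈ A)
    (hzo : N z o = 0) (hi : ∀ i, i ≠ o → N x i = N z i) : x = z + (N x o : ℝ) • u o := by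
  obtain ⟨t, ht⟩ := lineClass_eq_iff.mp ((h.lineClass_eq o hx hz).mpr hi)
  have h1 := h.coord_add_smul (k := t) (o := o) hz (ht ▸ hx) o
  rw [← ht, hzo, if_pos rfl, Nat.cast_zero, zero_add] at h1
  rwa [h1]

theorem coord_lt (h : IsChart A v u c N) (hA : IsSegmentClosed Λ A) {o : ι} {x z : V} (hx : x ∈ A)
    (hz : z ∈ A) (hzo : N z o = 0) (hi : ∀ i, i ≠ o → N x i = N z i) :
    N x o < #(lineFiber A (u o) (lineClass (u o) z)) := by
  rw [← h.add_smul_mem_iff hA hz hzo, ← h.eq_add_smul hx hz hzo hi]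
  exact hx

/-- The sum of all coordinates but one, as a functional. -/
theorem sum_erase_apply (h : IsChart A v u c N) (o : ι) {x : V} (hx : x ∈ A) :
    (∑ i ∈ univ.erase o, c i) x = (∑ i ∈ univ.erase o, c i) v + (∑ i ∈ univ.erase o, N x i : ℕ) := by
  rw [LinearMap.sum_apply, LinearMap.sum_apply, Nat.cast_sum, ← sum_add_distrib]
  exact sum_congr rfl fun i _ => h.apply_eq hx i

theorem opposite_mem (h : IsChart A v u c N) (hA : IsSegmentClosed Λ A) {o : ι} {m : ℕ}
    (hm : #(lineFiber A (u o) (lineClass (u o) v)) = m + 1) : v + (m : ℝ) • u o ∈ A := by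
  rw [h.add_smul_mem_iff hA h.origin_mem (h.coord_origin o), hm]
  exact m.lt_succ_self

theorem isVertex_opposite (h : IsChart A v u c N) (hA : IsSegmentClosed Λ A) {o : ι} {m : ℕ}
    (hm : #(lineFiber A (u o) (lineClass (u o) v)) = m + 1) : IsVertex A (v + (m : ℝ) • u o) := by
  have hw := h.opposite_mem hA hm
  refine ⟨hw, ((∑ x ∈ A, N x o + 1 : ℕ) : ℝ) • (∑ i ∈ univ.erase o, c i) - c o,
    fun x hx hxw => ?_⟩
  have hwc := h.coord_add_nat_smul h.origin_mem hw
  have hws : ∑ i ∈ univ.erase o, N (v + (m : ℝ) • u o) i = 0 := sum_eq_zero fun i hi => by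
    rw [hwc, if_neg (ne_of_mem_erase hi), h.coord_origin, add_zero]
  simp only [LinearMap.sub_apply, LinearMap.smul_apply, smul_eq_mul]
  rw [h.sum_erase_apply o hx, h.sum_erase_apply o hw, h.apply_eq hx, h.apply_eq hw, hws, hwc o,
    h.coord_origin, if_pos rfl]
  have hle : N x o ≤ ∑ x ∈ A, N x o := single_le_sum (f := fun x => N x o)
    (fun _ _ => Nat.zero_le _) hx
  suffices N x o + 1 ≤ m + (∑ x ∈ A, N x o + 1) * ∑ i ∈ univ.erase o, N x i by
    have h2 : (N x o + 1 : ℝ) ≤ m + ((∑ x ∈ A, N x o + 1 : ℕ) : ℝ) * (∑ i ∈ univ.erase o, N x i : ℕ) := by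
      exact_mod_cast this
    push_cast at *
    linarith
  rcases Nat.eq_zero_or_pos (∑ i ∈ univ.erase o, N x i) with h0 | h0
  · have hx0 : ∀ i, i ≠ o → N x i = N v i := fun i hi => by
      rw [sum_eq_zero_iff.mp h0 i (mem_erase.mpr ⟨hi, mem_univ i⟩), h.coord_origin]
    have h1 := h.coord_lt hA hx h.origin_mem (h.coord_origin o) hx0
    have h2 := h.eq_add_smul hx h.origin_mem (h.coord_origin o) hx0
    have h3 : N x o ≠ m := fun h3 => hxw (by rw [h2, h3])
    omega
  · nlinarith

/-- The inequality expressing that the vertex opposite to the origin along the axis `o` has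
linearly independent irreducibles as well. -/
theorem coord_add_le (h : IsChart A v u c N) (hA : IsSegmentClosed Λ A) {o : ι} {m : ℕ} {t : ι → ℕ}
    (hm : #(lineFiber A (u o) (lineClass (u o) v)) = m + 1)
    (ht : ∀ i, i ≠ o → #(lineFiber A (u o) (lineClass (u o) (v + u i))) = t i + 1)
    (hirr : #(irreducibles A (v + (m : ℝ) • u o)) = affRank A) {x : V} (hx : x ∈ A) :
    N x o + ∑ i ∈ univ.erase o, m * N x i ≤ m + ∑ i ∈ univ.erase o, t i * N x i := by
  have hw := h.opposite_mem hA hm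
  have hwv := h.isVertex_opposite hA hm
  have hwc := h.coord_add_nat_smul h.origin_mem hw
  have hm1 : 1 ≤ m := by
    have := (h.add_smul_mem_iff hA h.origin_mem (h.coord_origin o) 1).mp (by simpa using h.mem o)
    omega
  set w := v + (m : ℝ) • u o with hwdef
  have hline : ∀ a ∈ A, a ≠ w → (∀ i, i ≠ o → N a i = 0) → N a o < m := by
    intro a ha haw ha0
    have ha0' : ∀ i, i ≠ o → N a i = N v i := fun i hi => by rw [ha0 i hi, h.coord_origin]
    have h1 := h.coord_lt hA ha h.origin_mem (h.coord_origin o) ha0'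
    have h2 := h.eq_add_smul ha h.origin_mem (h.coord_origin o) ha0'
    have h3 : N a o ≠ m := fun h3 => haw (by rw [h2, h3])
    omega
  have hz₀ : v + ((m - 1 : ℕ) : ℝ) • u o ∈ A :=
    (h.add_smul_mem_iff hA h.origin_mem (h.coord_origin o) _).mpr (by omega)
  have hz₀c := h.coord_add_nat_smul h.origin_mem hz₀
  have hbase : ∀ i, i ≠ o → N (v + u i) o = 0 := fun i hi => by
    rw [h.coord_add, if_neg (Ne.symm hi)]
  have hz : ∀ i, i ≠ o → v + u i + (t i : ℝ) • u o ∈ A := fun i hi =>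
    (h.add_smul_mem_iff hA (h.mem i) (hbase i hi) _).mpr (by rw [ht i hi]; omega)
  have hzc : ∀ i, i ≠ o → ∀ j, N (v + u i + (t i : ℝ) • u o) j =
      (if j = i then 1 else 0) + if j = o then t i else 0 := fun i hi j => by
    rw [h.coord_add_nat_smul (h.mem i) (hz i hi), h.coord_add]
  have hirr₀ : v + ((m - 1 : ℕ) : ℝ) • u o ∈ irreducibles A w := by
    refine mem_irreducibles.mpr ⟨hz₀, fun he => ?_, fun a ha b hb haw hbw hab => ?_⟩
    · have h1 := hz₀c o
      rw [he, hwc, h.coord_origin, if_pos rfl, if_pos rfl] at h1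
      omega
    · have hs := h.add_eq ha hb hw hz₀ hab
      have h0 : ∀ i, i ≠ o → N a i + N b i = 0 := fun i hi => by
        rw [hs, hwc, hz₀c, h.coord_origin, if_neg hi, if_neg hi]
      have h1 := hline a ha haw fun i hi => by have := h0 i hi; omega
      have h2 := hline b hb hbw fun i hi => by have := h0 i hi; omega
      have h3 := hs o
      rw [hwc, hz₀c, h.coord_origin, if_pos rfl, if_pos rfl] at h3
      omega
  have hirr₁ : ∀ i, i ≠ o → v + u i + (t i : ℝ) • u o ∈ irreducibles A w := fun i hi => by
    refine mem_irreducibles.mpr ⟨hz i hi, fun he => ?_, fun a ha b hb haw hbw hab => ?_⟩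
    · have h1 := hzc i hi i
      rw [he, hwc, h.coord_origin, if_pos rfl, if_neg hi] at h1
      omega
    · have key : ∀ a ∈ A, ∀ b ∈ A, a ≠ w → a + b = w + (v + u i + (t i : ℝ) • u o) →
          N a i ≠ 0 := by
        intro a ha b hb haw hab ha0
        have hs := h.add_eq ha hb hw (hz i hi) hab
        have h0 : ∀ j, j ≠ o → N a j + N b j = if j = i then 1 else 0 := fun j hj => by
          rw [hs, hwc, hzc i hi, h.coord_origin, if_neg hj, if_neg hj]
          omega
        have h1 := hline a ha haw fun j hj => by
          have h00 := h0 j hj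
          split_ifs at h00 with hji
          · rwa [hji]
          · omega
        have h2 := h.coord_lt hA (o := o) hb (h.mem i) (hbase i hi) fun j hj => by
          have h00 := h0 j hj
          rw [h.coord_add]
          split_ifs at h00 ⊢ with hji
          · rw [hji] at h00 ⊢; omega
          · omega
        rw [ht i hi] at h2
        have h3 := hs o
        rw [hwc, hzc i hi, h.coord_origin, if_pos rfl, if_pos rfl, if_neg (Ne.symm hi)] at h3
        omega
      have h1 := key a ha b hb haw hab
      have h2 := key b hb a ha hbw (by rw [add_comm]; exact hab)
      have h3 := h.add_eq ha hb hw (hz i hi) hab i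
      rw [hwc, hzc i hi, h.coord_origin, if_neg hi, if_neg hi, if_pos rfl] at h3
      omega
  set z : ι → V := fun i => if i = o then v + ((m - 1 : ℕ) : ℝ) • u o else v + u i + (t i : ℝ) • u o
    with hzdef
  have hzinj : Function.Injective z := by
    intro i j hij
    simp only [hzdef] at hij
    by_contra hne
    split_ifs at hij with h1 h2 h2
    · exact hne (h1.trans h2.symm)
    · have := hz₀c j
      rw [hij, hzc j h2, h.coord_origin, if_pos rfl, if_neg h2, if_neg h2] at this
      omega
    · have := hz₀c i
      rw [← hij, hzc i h1, h.coord_origin, if_pos rfl, if_neg h1, if_neg h1] at this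
      omega
    · have := hzc i h1 i
      rw [hij, hzc j h2, if_neg hne, if_pos rfl, if_neg h1] at this
      omega
  have hirrEq : univ.image z = irreducibles A w := by
    refine eq_of_subset_of_card_le (image_subset_iff.mpr fun i _ => ?_) ?_
    · simp only [hzdef]
      split_ifs with hi
      · exact hirr₀
      · exact hirr₁ i hi
    · rw [card_image_of_injective _ hzinj, card_univ, h.card_eq, hirr]
  set g : V →ₗ[ℝ] ℝ := c o + ∑ i ∈ univ.erase o, ((m : ℝ) - t i) • c i with hg
  have hgA : ∀ a ∈ A, g a = g v + (N a o + ∑ i ∈ univ.erase o, ((m : ℝ) - t i) * N a i) := by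
    intro a ha
    simp only [hg, LinearMap.add_apply, LinearMap.sum_apply, LinearMap.smul_apply, smul_eq_mul]
    rw [h.apply_eq ha, sum_congr rfl fun i _ => by rw [h.apply_eq ha, mul_add], sum_add_distrib]
    ring
  have hgw : g w = g v + m := by
    rw [hgA w hw, hwc, h.coord_origin, if_pos rfl, sum_eq_zero fun i hi => by
      rw [hwc, h.coord_origin, if_neg (ne_of_mem_erase hi)]; simp]
    simp
  have hgirr : ∀ y ∈ irreducibles A w, g (y - w) ≤ 0 := by
    intro y hy
    rw [← hirrEq] at hy
    obtain ⟨i, -, rfl⟩ := mem_image.mp hy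
    rw [map_sub, hgw]
    simp only [hzdef]
    split_ifs with hi
    · rw [hgA _ hz₀, hz₀c, h.coord_origin, if_pos rfl, sum_eq_zero fun i hi => by
        rw [hz₀c, h.coord_origin, if_neg (ne_of_mem_erase hi)]; simp]
      rw [Nat.cast_add, Nat.cast_sub hm1]
      simp
    · rw [hgA _ (hz i hi), hzc i hi, if_pos rfl, if_neg (Ne.symm hi),
        sum_eq_single_of_mem i (mem_erase.mpr ⟨hi, mem_univ i⟩) fun j hj hji => by
          rw [hzc i hi, if_neg hji, if_neg (ne_of_mem_erase hj)]; simp]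
      rw [hzc i hi, if_pos rfl, if_neg hi]
      simp
  obtain ⟨M, hM⟩ := exists_nat_combination hwv hx
  have hgx : g x ≤ g w := by
    rw [hM, map_add, map_sum]
    have : ∑ y : irreducibles A w, g ((M y : ℝ) • ((y : V) - w)) ≤ 0 := sum_nonpos fun y _ => by
      rw [map_smul, smul_eq_mul]
      exact mul_nonpos_of_nonneg_of_nonpos (Nat.cast_nonneg _) (hgirr y y.2)
    linarith
  rw [hgA x hx, hgw] at hgx
  simp only [sub_mul, sum_sub_distrib] at hgx
  have : (N x o + ∑ i ∈ univ.erase o, (m : ℝ) * N x i) ≤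
      m + ∑ i ∈ univ.erase o, (t i : ℝ) * N x i := by linarith
  exact_mod_cast this

/-- The points of `A` on the axis `o`. -/
noncomputable def edge (A : Finset V) (v : V) (u : ι → V) (o : ι) : Finset V :=
  lineFiber A (u o) (lineClass (u o) v)

theorem mem_edge (h : IsChart A v u c N) {o : ι} {x : V} :
    x ∈ edge A v u o ↔ x ∈ A ∧ ∑ i ∈ univ.erase o, N x i = 0 := by
  rw [edge, mem_lineFiber]
  refine and_congr_right fun hx => ?_
  rw [h.lineClass_eq o hx h.origin_mem, sum_eq_zero_iff]
  simp only [h.coord_origin, mem_erase, mem_univ, and_true]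

theorem mem_sdiff_edge (h : IsChart A v u c N) {o : ι} {x : V} :
    x ∈ A \ edge A v u o ↔ x ∈ A ∧ 1 ≤ ∑ i ∈ univ.erase o, N x i := by
  rw [mem_sdiff, h.mem_edge, Nat.one_le_iff_ne_zero]
  tauto

theorem edge_subset {ι : Type*} {u : ι → V} (o : ι) : edge A v u o ⊆ A := filter_subset _ _

theorem edge_union_sdiff {ι : Type*} {u : ι → V} (o : ι) : edge A v u o ∪ (A \ edge A v u o) = A :=
  union_sdiff_of_subset (edge_subset o)

theorem apply_edge (h : IsChart A v u c N) {o : ι} {x : V} (hx : x ∈ edge A v u o) :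
    (∑ i ∈ univ.erase o, c i) x = (∑ i ∈ univ.erase o, c i) v := by
  obtain ⟨hx, h0⟩ := h.mem_edge.mp hx
  rw [h.sum_erase_apply o hx, h0]
  simp

theorem lt_apply_sdiff_edge (h : IsChart A v u c N) {o : ι} {x : V} (hx : x ∈ A \ edge A v u o) :
    (∑ i ∈ univ.erase o, c i) v + 1 ≤ (∑ i ∈ univ.erase o, c i) x := by
  obtain ⟨hx, h0⟩ := h.mem_sdiff_edge.mp hx
  rw [h.sum_erase_apply o hx]
  have : (1 : ℝ) ≤ (∑ i ∈ univ.erase o, N x i : ℕ) := by exact_mod_cast h0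
  linarith

theorem isSegmentClosed_sdiff_edge (h : IsChart A v u c N) (hA : IsSegmentClosed Λ A) (o : ι) :
    IsSegmentClosed Λ (A \ edge A v u o) := by
  refine ⟨fun x hx => hA.1 x (mem_sdiff.mp hx).1, fun x hx y hy z hz hzs => ?_⟩
  refine mem_sdiff.mpr ⟨hA.2 x (mem_sdiff.mp hx).1 y (mem_sdiff.mp hy).1 z hz hzs, fun hzE => ?_⟩
  obtain ⟨a, b, ha, hb, hab, rfl⟩ := hzs
  have h1 := h.apply_edge hzE
  have h2 := h.lt_apply_sdiff_edge hx
  have h3 := h.lt_apply_sdiff_edge hy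
  rw [map_add, map_smul, map_smul, smul_eq_mul, smul_eq_mul] at h1
  have h4 := mul_le_mul_of_nonneg_left h2 ha
  have h5 := mul_le_mul_of_nonneg_left h3 hb
  have h6 : (a + b) * ((∑ i ∈ univ.erase o, c i) v + 1) ≤ (∑ i ∈ univ.erase o, c i) v := by
    rw [add_mul]; linarith
  rw [hab] at h6
  linarith

theorem sum_erase_coord_add (h : IsChart A v u c N) {o j : ι} (hj : j ≠ o) :
    ∑ i ∈ univ.erase o, N (v + u j) i = 1 := by
  rw [sum_eq_single_of_mem j (mem_erase.mpr ⟨hj, mem_univ j⟩) fun i _ hij => by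
    rw [h.coord_add, if_neg hij], h.coord_add, if_pos rfl]

theorem add_mem_sdiff_edge (h : IsChart A v u c N) {o j : ι} (hj : j ≠ o) :
    v + u j ∈ A \ edge A v u o :=
  h.mem_sdiff_edge.mpr ⟨h.mem j, (h.sum_erase_coord_add hj).ge⟩

theorem exists_two_le_sum (h : IsChart A v u c N) (hnc : ¬CoveredByLines A) (o : ι) :
    ∃ x ∈ A, 2 ≤ ∑ i ∈ univ.erase o, N x i := by
  by_contra hcon
  push Not at hcon
  exact hnc (h.coveredByLines o fun x hx => Nat.le_of_lt_succ (hcon x hx))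

theorem coord_base (h : IsChart A v u c N) {o j : ι} (hj : j ≠ o) : N (v + u j) o = 0 := by
  rw [h.coord_add, if_neg (Ne.symm hj)]

theorem affRank_sdiff_edge (h : IsChart A v u c N) (hA : IsSegmentClosed Λ A)
    (hnc : ¬CoveredByLines A) {o j : ι} (hj : j ≠ o)
    (hj2 : 2 ≤ #(lineFiber A (u o) (lineClass (u o) (v + u j)))) :
    affRank (A \ edge A v u o) = affRank A := by
  refine le_antisymm (affRank_mono sdiff_subset) ?_
  have := vectorSpan_finite (A \ edge A v u o)
  refine Submodule.finrank_mono ?_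
  set W := vectorSpan ℝ ((A \ edge A v u o : Finset V) : Set V) with hW
  have hsub : ∀ x ∈ A \ edge A v u o, ∀ z ∈ A \ edge A v u o, x - z ∈ W := fun x hx z hz =>
    vsub_mem_vectorSpan ℝ (mem_coe.mpr hx) (mem_coe.mpr hz)
  have hjo : v + u j + u o ∈ A := by
    have := (h.add_smul_mem_iff hA (h.mem j) (h.coord_base hj) 1).mpr (by omega)
    simpa using this
  have huo : u o ∈ W := by
    have := hsub (v + u j + u o) (h.mem_sdiff_edge.mpr ⟨hjo, ?_⟩) _ (h.add_mem_sdiff_edge hj)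
    · simpa using this
    · rw [← h.sum_erase_coord_add hj]
      refine sum_le_sum fun i _ => ?_
      have := h.coord_add_nat_smul (k := 1) (o := o) (h.mem j) (by simpa using hjo) i
      simp only [Nat.cast_one, one_smul] at this
      omega
  have hdiff : ∀ i, i ≠ o → u i - u j ∈ W := fun i hi => by
    simpa using hsub _ (h.add_mem_sdiff_edge hi) _ (h.add_mem_sdiff_edge hj)
  have huj : u j ∈ W := by
    obtain ⟨x, hx, hx2⟩ := h.exists_two_le_sum hnc o
    have h1 := hsub x (h.mem_sdiff_edge.mpr ⟨hx, by omega⟩) _ (h.add_mem_sdiff_edge hj)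
    have h2 : ((∑ i ∈ univ.erase o, N x i : ℕ) - 1 : ℝ) • u j = x - (v + u j) -
        (N x o : ℝ) • u o - ∑ i ∈ univ.erase o, (N x i : ℝ) • (u i - u j) := by
      simp only [smul_sub, sum_sub_distrib]
      rw [← sum_smul]
      have h3 : x - (v + u j) = (N x o : ℝ) • u o + ∑ i ∈ univ.erase o, (N x i : ℝ) • u i - u j := by
        rw [add_sum_erase _ (fun i => (N x i : ℝ) • u i) (mem_univ o)]
        nth_rewrite 1 [h.eq_sum x hx]
        abel
      rw [h3, sub_smul]
      push_cast
      rw [one_smul]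
      abel
    have h4 : ((∑ i ∈ univ.erase o, N x i : ℕ) - 1 : ℝ) • u j ∈ W := by
      rw [h2]
      exact W.sub_mem (W.sub_mem h1 (W.smul_mem _ huo))
        (W.sum_mem fun i hi => W.smul_mem _ (hdiff i (ne_of_mem_erase hi)))
    refine (W.smul_mem_iff ?_).mp h4
    have : (2 : ℝ) ≤ (∑ i ∈ univ.erase o, N x i : ℕ) := by exact_mod_cast hx2
    linarith
  have hu : ∀ i, u i ∈ W := fun i => by
    by_cases hi : i = o
    · rw [hi]; exact huo
    · simpa using W.add_mem (hdiff i hi) huj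
  rw [vectorSpan_eq_span_vsub_set_right ℝ (p := v) (mem_coe.mpr h.origin_mem), Submodule.span_le]
  rintro _ ⟨x, hx, rfl⟩
  have : x -ᵥ v = ∑ i, (N x i : ℝ) • u i := by
    rw [vsub_eq_sub]
    nth_rewrite 1 [h.eq_sum x hx]
    abel
  simp only [SetLike.mem_coe]
  rw [this]
  exact W.sum_mem fun i _ => W.smul_mem _ (hu i)

theorem lineClass_injOn (h : IsChart A v u c N) (o : ι) :
    Set.InjOn (fun i => lineClass (u o) (v + u i)) (univ.erase o : Finset ι) := by
  intro i hi j hj hij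
  have hi' := ne_of_mem_erase (mem_coe.mp hi)
  have := (h.lineClass_eq o (h.mem i) (h.mem j)).mp hij i hi'
  rw [h.coord_add, h.coord_add, if_pos rfl] at this
  by_contra hne
  rw [if_neg hne] at this
  omega

theorem card_sdiff_edge_add {ι : Type*} (A : Finset V) (v : V) (u : ι → V) (o : ι) :
    #(A \ edge A v u o) + #(edge A v u o) = #A :=
  card_sdiff_add_card_eq_card (edge_subset o)

theorem doublingExcess_sdiff_edge (h : IsChart A v u c N) {o : ι}
    {t : ι → ℕ}
    (ht : ∀ i, i ≠ o → #(lineFiber A (u o) (lineClass (u o) (v + u i))) = t i + 1)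
    (hr : affRank (A \ edge A v u o) = affRank A) :
    doublingExcess (A \ edge A v u o) + 2 * (∑ i ∈ univ.erase o, t i - 1) ≤ doublingExcess A := by
  set E := edge A v u o with hE
  set L := (univ.erase o).biUnion fun i => lineFiber A (u o) (lineClass (u o) (v + u i)) with hL
  have hLmem : ∀ x ∈ L, x ∈ A ∧ ∑ i ∈ univ.erase o, N x i = 1 := by
    intro x hx
    obtain ⟨i, hi, hxi⟩ := mem_biUnion.mp hx
    obtain ⟨hxA, hxi⟩ := mem_lineFiber.mp hxi
    refine ⟨hxA, ?_⟩
    rw [← h.sum_erase_coord_add (ne_of_mem_erase hi)]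
    exact sum_congr rfl fun j hj =>
      (h.lineClass_eq o hxA (h.mem i)).mp hxi j (ne_of_mem_erase hj)
  have hLcard : #L = ∑ i ∈ univ.erase o, t i + #(univ.erase o) := by
    rw [hL, card_biUnion, sum_congr rfl fun i hi => ht i (ne_of_mem_erase hi), sum_add_distrib,
      card_eq_sum_ones]
    intro i hi j hj hij
    refine disjoint_left.mpr fun x hx hx' => hij (h.lineClass_injOn o (mem_coe.mpr hi)
      (mem_coe.mpr hj) ?_)
    exact (mem_lineFiber.mp hx).2.symm.trans (mem_lineFiber.mp hx').2
  have hLimg : L.image (lineClass (u o)) =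
      (univ.erase o).image fun i => lineClass (u o) (v + u i) := by
    ext p
    constructor
    · intro hp
      obtain ⟨x, hx, rfl⟩ := mem_image.mp hp
      obtain ⟨i, hi, hxi⟩ := mem_biUnion.mp hx
      exact mem_image.mpr ⟨i, hi, (mem_lineFiber.mp hxi).2.symm⟩
    · intro hp
      obtain ⟨i, hi, rfl⟩ := mem_image.mp hp
      exact mem_image_of_mem _ (mem_biUnion.mpr ⟨i, hi, mem_lineFiber.mpr ⟨h.mem i, rfl⟩⟩)
  have hLimgc : #(L.image (lineClass (u o))) = #(univ.erase o) := by
    rw [hLimg, card_image_of_injOn (h.lineClass_injOn o)]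
  have hLB : L ⊆ A \ E := fun x hx =>
    h.mem_sdiff_edge.mpr ⟨(hLmem x hx).1, (hLmem x hx).2.ge⟩
  have hEne : E.Nonempty := ⟨v, mem_lineFiber.mpr ⟨h.origin_mem, rfl⟩⟩
  have hface := card_add_of_face (E := E) (B := A \ E) (X := E + L) (∑ i ∈ univ.erase o, c i)
    (fun x hx => h.apply_edge hx) (fun x hx => by linarith [h.lt_apply_sdiff_edge hx])
    (add_subset_add_left hLB) (disjoint_left.mpr fun z hz hz' => by
      obtain ⟨e, he, x, hx, rfl⟩ := mem_add.mp hz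
      obtain ⟨b, hb, b', hb', hbb⟩ := mem_add.mp hz'
      have h1 := congrArg (∑ i ∈ univ.erase o, c i : V →ₗ[ℝ] ℝ) hbb
      rw [map_add, map_add, h.apply_edge he, h.sum_erase_apply o (hLmem x hx).1,
        (hLmem x hx).2, Nat.cast_one] at h1
      linarith [h.lt_apply_sdiff_edge hb, h.lt_apply_sdiff_edge hb'])
  rw [hE, edge_union_sdiff, ← hE] at hface
  have hconst := card_add_of_const (lineClass (u o)).toAddMonoidHom L hEne
    (q := lineClass (u o) v) fun x hx => (mem_lineFiber.mp hx).2
  rw [show L.image (lineClass (u o)).toAddMonoidHom = L.image (lineClass (u o)) from rfl, hLimgc,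
    hLcard] at hconst
  have hEE := card_add_card_le_card_add hEne hEne
  have hc := card_sdiff_edge_add A v u o
  rw [← hE] at hc
  have hro := card_erase_add_one (mem_univ o)
  rw [card_univ, h.card_eq] at hro
  unfold doublingExcess
  rw [hr, ← hro, ← hc]
  generalize #(univ.erase o) = r at *
  generalize ∑ i ∈ univ.erase o, t i = T at *
  push_cast
  zify at hface hconst hEE
  nlinarith

theorem surplus_sdiff_edge {ι : Type*} {u : ι → V} {o : ι} (hr : affRank (A \ edge A v u o) = affRank A) :
    surplus A = surplus (A \ edge A v u o) + #(edge A v u o) := by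
  have hc := card_sdiff_edge_add A v u o
  unfold surplus
  rw [hr, ← hc]
  push_cast
  ring

variable {o : ι} {m : ℕ} {t : ι → ℕ}

theorem le_card_lineFiber (h : IsChart A v u c N) (hA : IsSegmentClosed Λ A) {i : ι} (hi : i ≠ o)
    (ho : v + (m : ℝ) • u o ∈ A) (hi' : v + (m : ℝ) • u i ∈ A) :
    m ≤ #(lineFiber A (u o) (lineClass (u o) (v + u i))) := by
  rcases Nat.eq_zero_or_pos m with hm | hm
  · omega
  have hmem : v + u i + ((m - 1 : ℕ) : ℝ) • u o ∈ A := by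
    refine hA.2 _ hi' _ ho _ ?_ ?_
    · rw [Nat.cast_smul_eq_nsmul]
      exact Λ.add_mem (hA.1 _ (h.mem i)) (Λ.nsmul_mem (h.direction_mem hA o) _)
    · have hm' : (0 : ℝ) < m := by exact_mod_cast hm
      have hm1 : (1 : ℝ) ≤ m := by exact_mod_cast hm
      refine ⟨1 / m, 1 - 1 / m, by positivity, ?_, by ring, ?_⟩
      · rw [sub_nonneg, div_le_one hm']; exact hm1
      · rw [Nat.cast_sub hm, smul_add, smul_add, smul_smul, smul_smul, add_add_add_comm, ← add_smul,
          one_div_mul_cancel hm'.ne', sub_mul, one_div_mul_cancel hm'.ne', Nat.cast_one,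
          add_sub_cancel, one_smul, one_smul, one_mul, add_assoc]
  have := (h.add_smul_mem_iff hA (h.mem i) (h.coord_base hi) _).mp hmem
  omega

theorem sum_coord_le (hle : ∀ x ∈ A, N x o + ∑ i ∈ univ.erase o, m * N x i ≤
      m + ∑ i ∈ univ.erase o, t i * N x i)
    (hmt : ∀ i, i ≠ o → m = t i + 1) : ∀ x ∈ A, ∑ i, N x i ≤ m := by
  intro x hx
  have h1 := hle x hx
  rw [sum_congr rfl fun i hi => by rw [hmt i (ne_of_mem_erase hi), add_mul, one_mul],
    sum_add_distrib] at h1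
  rw [← add_sum_erase _ _ (mem_univ o)]
  omega

theorem card_erase_eq (h : IsChart A v u c N) (o : ι) : #(univ.erase o) + 1 = affRank A := by
  rw [card_erase_add_one (mem_univ o), card_univ, h.card_eq]

theorem mul_card_le_sum (htm : ∀ i, i ≠ o → m ≤ t i + 1) :
    #(univ.erase o) * (m - 1) ≤ ∑ i ∈ univ.erase o, t i := by
  rw [← smul_eq_mul, ← sum_const]
  refine sum_le_sum fun i hi => ?_
  have := htm i (ne_of_mem_erase hi)
  omega

theorem not_sum_lt (h : IsChart A v u c N) (hA : IsSegmentClosed Λ A) (hnc : ¬CoveredByLines A)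
    (hm : 1 ≤ m)
    (ht : ∀ i, i ≠ o → #(lineFiber A (u o) (lineClass (u o) (v + u i))) = t i + 1)
    (hle : ∀ x ∈ A, N x o + ∑ i ∈ univ.erase o, m * N x i ≤ m + ∑ i ∈ univ.erase o, t i * N x i)
    (htm : ∀ i, i ≠ o → m ≤ t i + 1) (hexc : 3 * doublingExcess A + 8 ≤ 2 * surplus A)
    (hexcep : ¬(surplus A = 7 ∧ doublingExcess A = 2)) :
    m + 4 ≤ 3 * ∑ i ∈ univ.erase o, t i := by
  by_contra! hT
  obtain ⟨x₀, -, hx₀⟩ := h.exists_two_le_sum hnc o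
  have hne : (univ.erase o).Nonempty := by
    by_contra hcon
    rw [not_nonempty_iff_eq_empty] at hcon
    simp [hcon] at hx₀
  have hpos := card_pos.mpr hne
  have hsum := mul_card_le_sum htm
  have hr := h.card_erase_eq o
  rcases hm.eq_or_lt with rfl | hm2
  · obtain ⟨j, hj, hj0⟩ : ∃ j, j ≠ o ∧ ∀ i, i ≠ o → i ≠ j → t i = 0 := by
      by_cases hall : ∀ i, i ≠ o → t i = 0
      · obtain ⟨j, hj⟩ := hne
        exact ⟨j, ne_of_mem_erase hj, fun i hi _ => hall i hi⟩
      · push Not at hall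
        obtain ⟨j, hj, hj0⟩ := hall
        refine ⟨j, hj, fun i hi hij => ?_⟩
        have h1 : t i ≤ ∑ i ∈ (univ.erase o).erase j, t i := single_le_sum
          (fun _ _ => Nat.zero_le _) (mem_erase.mpr ⟨hij, mem_erase.mpr ⟨hi, mem_univ i⟩⟩)
        rw [← add_sum_erase _ _ (mem_erase.mpr ⟨hj, mem_univ j⟩ : j ∈ univ.erase o)] at hT
        omega
    have hj' : j ∈ univ.erase o := mem_erase.mpr ⟨hj, mem_univ j⟩
    refine hnc (h.coveredByLines j fun x hx => ?_)
    have h1 := hle x hx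
    rw [← add_sum_erase _ _ hj', ← add_sum_erase _ (fun i => t i * N x i) hj',
      sum_eq_zero (f := fun i => t i * N x i) (s := (univ.erase o).erase j) fun i hi => by
        rw [hj0 i (ne_of_mem_erase (mem_of_mem_erase hi)) (ne_of_mem_erase hi), zero_mul]] at h1
    simp only [one_mul] at h1
    rw [← add_sum_erase _ _ (mem_erase.mpr ⟨hj.symm, mem_univ o⟩ : o ∈ univ.erase j),
      erase_right_comm]
    have htj : t j ≤ 1 := by
      have : t j ≤ ∑ i ∈ univ.erase o, t i := single_le_sum (fun _ _ => Nat.zero_le _) hj'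
      omega
    have : t j * N x j ≤ N x j := by nlinarith
    omega
  · have hcard : #(univ.erase o) = 1 := by
      by_contra hc
      have : 2 * (m - 1) ≤ #(univ.erase o) * (m - 1) := Nat.mul_le_mul_right _ (by omega)
      omega
    obtain ⟨j, hj⟩ := card_eq_one.mp hcard
    have hjo : ∀ i, i ≠ o → i = j := fun i hi => by
      have : i ∈ univ.erase o := mem_erase.mpr ⟨hi, mem_univ i⟩
      rwa [hj, mem_singleton] at this
    have hjne : j ≠ o := ne_of_mem_erase (hj ▸ mem_singleton_self j : j ∈ univ.erase o)
    rw [hcard, one_mul] at hsum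
    rw [hj, sum_singleton] at hT hsum
    have hmt : ∀ i, i ≠ o → m = t i + 1 := fun i hi => by
      rw [hjo i hi]; omega
    have hAle := h.card_le_choose (sum_coord_le hle hmt)
    rw [← hr, hcard] at hAle
    have hmj := hmt j hjne
    have hexc0 := doublingExcess_nonneg ⟨v, h.origin_mem⟩
    have hm3 : m = 2 ∨ m = 3 := by omega
    rcases hm3 with rfl | rfl
    · norm_num [Nat.choose] at hAle
      unfold surplus at hexc
      omega
    · norm_num [Nat.choose] at hAle
      have haff := h.affRank_sdiff_edge hA hnc hjne (by rw [ht j hjne]; omega)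
      have h1 := h.doublingExcess_sdiff_edge ht haff
      rw [hj, sum_singleton] at h1
      have h2 := doublingExcess_nonneg ⟨_, h.add_mem_sdiff_edge hjne⟩
      unfold surplus at hexc hexcep
      omega

theorem not_planar_exception (h : IsChart A v u c N) (hA : IsSegmentClosed Λ A)
    (hm : #(lineFiber A (u o) (lineClass (u o) v)) = 3) (hbound : ∀ x ∈ A, N x o ≤ 2)
    (hr : affRank A = 2) (hcard : #A = 13) : 4 < doublingExcess A := by
  set C : ℕ → Finset V := fun i => {x ∈ A | N x o = i} with hC
  set D : ℕ → Finset V := fun k => {z ∈ A + A | c o z = 2 * c o v + k} with hD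
  have hCD : ∀ i j, C i + C j ⊆ D (i + j) := by
    intro i j z hz
    obtain ⟨a, ha, b, hb, rfl⟩ := mem_add.mp hz
    obtain ⟨haA, hai⟩ := mem_filter.mp ha
    obtain ⟨hbA, hbj⟩ := mem_filter.mp hb
    refine mem_filter.mpr ⟨add_mem_add haA hbA, ?_⟩
    rw [map_add, h.apply_eq haA, h.apply_eq hbA, hai, hbj]
    push_cast
    ring
  have hCne : ∀ i, i < 3 → (C i).Nonempty := by
    intro i hi
    have hmem := (h.add_smul_mem_iff hA h.origin_mem (h.coord_origin o) i).mpr (by rwa [hm])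
    refine ⟨_, mem_filter.mpr ⟨hmem, ?_⟩⟩
    rw [h.coord_add_nat_smul h.origin_mem hmem, h.coord_origin, if_pos rfl, zero_add]
  have hsumC : #A = ∑ i ∈ range 3, #(C i) :=
    card_eq_sum_card_fiberwise fun x hx => by
      have := hbound x hx
      simp
      omega
  have hsumD : ∑ k ∈ range 5, #(D k) ≤ #(A + A) := by
    rw [← card_biUnion]
    · exact card_le_card (biUnion_subset.mpr fun k _ => filter_subset _ _)
    · intro k _ l _ hkl
      refine disjoint_left.mpr fun z hz hz' => hkl ?_
      have h1 := (mem_filter.mp hz).2.symm.trans (mem_filter.mp hz').2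
      exact_mod_cast add_left_cancel h1
  have hle : ∀ i j, i < 3 → j < 3 → #(C i) + #(C j) ≤ #(D (i + j)) + 1 := fun i j hi hj =>
    (card_add_card_le_card_add (hCne i hi) (hCne j hj)).trans
      (Nat.add_le_add_right (card_le_card (hCD i j)) 1)
  have h00 := hle 0 0 (by norm_num) (by norm_num)
  have h01 := hle 0 1 (by norm_num) (by norm_num)
  have h11 := hle 1 1 (by norm_num) (by norm_num)
  have h02 := hle 0 2 (by norm_num) (by norm_num)
  have h12 := hle 1 2 (by norm_num) (by norm_num)
  have h22 := hle 2 2 (by norm_num) (by norm_num)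
  simp only [sum_range_succ, range_zero, sum_empty, zero_add, Nat.reduceAdd] at *
  unfold doublingExcess
  rw [hr]
  push_cast
  omega

theorem not_exception (h : IsChart A v u c N) (hA : IsSegmentClosed Λ A)
    (hm : #(lineFiber A (u o) (lineClass (u o) v)) = m + 1)
    (ht : ∀ i, i ≠ o → #(lineFiber A (u o) (lineClass (u o) (v + u i))) = t i + 1)
    (hle : ∀ x ∈ A, N x o + ∑ i ∈ univ.erase o, m * N x i ≤ m + ∑ i ∈ univ.erase o, t i * N x i)
    (htm : ∀ i, i ≠ o → m ≤ t i + 1) (hexc : 3 * doublingExcess A + 8 ≤ 2 * surplus A)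
    (hT : m + 4 ≤ 3 * ∑ i ∈ univ.erase o, t i)
    (hr : affRank (A \ edge A v u o) = affRank A) :
    ¬(surplus (A \ edge A v u o) = 7 ∧ doublingExcess (A \ edge A v u o) = 2) := by
  rintro ⟨h7, h2⟩
  have hs := surplus_sdiff_edge hr
  have he := h.doublingExcess_sdiff_edge ht hr
  rw [edge, hm, ← edge, h7] at hs
  rw [h2] at he
  have hsum := mul_card_le_sum htm
  have hrk := h.card_erase_eq o
  have hT' : 3 * ∑ i ∈ univ.erase o, t i = m + 4 := by
    zify at *; linarith
  have hm2 : 2 ≤ m := by omega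
  have hc2 : #(univ.erase o) ≤ 2 := by
    by_contra hc
    have : 3 * (m - 1) ≤ #(univ.erase o) * (m - 1) := Nat.mul_le_mul_right _ (by omega)
    omega
  interval_cases hc : #(univ.erase o)
  · rw [card_eq_zero] at hc
    simp [hc] at hT'
  · have hm' : m = 2 := by omega
    subst hm'
    obtain ⟨j, hj⟩ := card_eq_one.mp hc
    rw [hj, sum_singleton] at he hT'
    have h4 := h.not_planar_exception hA hm (fun x hx => by
      have := hle x hx
      rw [hj, sum_singleton, sum_singleton, show t j = 2 by omega] at this
      omega) hrk.symm (by unfold surplus at hs; omega)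
    omega
  · have hm' : m = 2 := by omega
    subst hm'
    have hle1 : ∀ i ∈ univ.erase o, 1 ≤ t i := fun i hi => by
      have := htm i (ne_of_mem_erase hi)
      omega
    have hmt : ∀ i, i ≠ o → 2 = t i + 1 := fun i hi => by
      have := (sum_eq_sum_iff_of_le hle1).mp
        (by rw [← card_eq_sum_ones]; omega) i (mem_erase.mpr ⟨hi, mem_univ i⟩)
      omega
    have hAle := h.card_le_choose (sum_coord_le hle hmt)
    rw [← hrk] at hAle
    norm_num [Nat.choose] at hAle
    unfold surplus at hs
    omega

theorem not_parallel (h : IsChart A v u c N) (hnc : ¬CoveredByLines A)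
    (hexc : 3 * doublingExcess A + 8 ≤ 2 * surplus A)
    (hr : affRank (A \ edge A v u o) = affRank A) {y : V} (hstep : IsStep (A \ edge A v u o) y)
    (hcov : #((A \ edge A v u o).image (lineClass y)) ≤ affRank (A \ edge A v u o)) :
    lineClass y (u o) ≠ 0 := by
  intro huo
  have hconst : ∀ x : V, ∀ s : ℝ, lineClass y (x + s • u o) = lineClass y x := fun x s => by
    rw [map_add, map_smul, huo, smul_zero, add_zero]
  have hEq : ∀ x ∈ edge A v u o, lineClass y x = lineClass y v := by
    intro x hx
    obtain ⟨hx, h0⟩ := h.mem_edge.mp hx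
    rw [h.eq_add_smul hx h.origin_mem (h.coord_origin o) fun i hi => by
      rw [sum_eq_zero_iff.mp h0 i (mem_erase.mpr ⟨hi, mem_univ i⟩), h.coord_origin]]
    exact hconst _ _
  have hq : lineClass y v ∉ (A \ edge A v u o).image (lineClass y) := by
    intro hq
    refine hnc ⟨y, hstep.1, ?_⟩
    rw [← hr]
    refine (card_le_card fun p hp => ?_).trans hcov
    obtain ⟨x, hx, rfl⟩ := mem_image.mp hp
    by_cases hxE : x ∈ edge A v u o
    · rwa [hEq x hxE]
    · exact mem_image_of_mem _ (mem_sdiff.mpr ⟨hx, hxE⟩)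
  obtain ⟨x₀, hx₀, hx₀2⟩ := h.exists_two_le_sum hnc o
  obtain ⟨x, hx, hmin⟩ := exists_min_image {x ∈ A | 2 ≤ ∑ i ∈ univ.erase o, N x i}
    (fun x => N x o) ⟨x₀, mem_filter.mpr ⟨hx₀, hx₀2⟩⟩
  obtain ⟨hxA, hx2⟩ := mem_filter.mp hx
  have hne : ∀ i, x ≠ v + u i := fun i hxi => by
    by_cases hi : i = o
    · have : ∑ j ∈ univ.erase o, N x j = 0 := sum_eq_zero fun j hj => by
        rw [hxi, h.coord_add, hi, if_neg (ne_of_mem_erase hj)]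
      omega
    · rw [hxi, h.sum_erase_coord_add hi] at hx2
      omega
  obtain ⟨a, ha, b, hb, hav, hbv, hab⟩ := h.exists_add_eq x hxA (fun hxv => by
    rw [hxv, sum_eq_zero fun i _ => h.coord_origin i] at hx2; omega) hne
  have key : ∀ a ∈ A, ∀ b ∈ A, a ≠ v → a + b = v + x → a ∈ A \ edge A v u o := by
    intro a ha b hb hav hab
    refine mem_sdiff.mpr ⟨ha, fun haE => ?_⟩
    have hs := h.add_eq ha hb h.origin_mem hxA hab
    simp only [h.coord_origin, zero_add] at hs
    have ha0 := (h.mem_edge.mp haE).2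
    have hao : N a o ≠ 0 := fun hao => hav (h.ext ha h.origin_mem fun i => by
      rw [h.coord_origin]
      by_cases hi : i = o
      · rw [hi, hao]
      · exact sum_eq_zero_iff.mp ha0 i (mem_erase.mpr ⟨hi, mem_univ i⟩))
    have hb2 : 2 ≤ ∑ i ∈ univ.erase o, N b i := by
      have : ∑ i ∈ univ.erase o, N a i + ∑ i ∈ univ.erase o, N b i =
          ∑ i ∈ univ.erase o, N x i := by
        rw [← sum_add_distrib]
        exact sum_congr rfl fun i _ => hs i
      omega
    have h1 := hmin b (mem_filter.mpr ⟨hb, hb2⟩)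
    have h2 := hs o
    omega
  have hrel : lineClass y v + lineClass y x = lineClass y a + lineClass y b := by
    rw [← map_add, ← map_add, hab]
  have hxB : x ∈ A \ edge A v u o := h.mem_sdiff_edge.mpr ⟨hxA, by omega⟩
  have hmain := two_mul_surplus_lt_of_split (E := edge A v u o) hstep
    ⟨v, mem_lineFiber.mpr ⟨h.origin_mem, rfl⟩⟩ ⟨x, hxB⟩ hEq hq hcov
    (by rw [edge_union_sdiff, hr]) (∑ i ∈ univ.erase o, c i)
    (fun x hx => h.apply_edge hx) (fun x hx => by linarith [h.lt_apply_sdiff_edge hx])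
    (Or.inr ⟨_, mem_image_of_mem _ hxB, _, mem_image_of_mem _ (key a ha b hb hav hab), _,
      mem_image_of_mem _ (key b hb a ha hbv (by rw [add_comm]; exact hab)), hrel⟩)
  rw [edge_union_sdiff] at hmain
  linarith

variable {y : V}

theorem add_smul_mem_sdiff_edge (h : IsChart A v u c N) (hA : IsSegmentClosed Λ A)
    (ht : ∀ i, i ≠ o → #(lineFiber A (u o) (lineClass (u o) (v + u i))) = t i + 1) {j : ι}
    (hj : j ≠ o) {n : ℕ} (hn : n ≤ t j) : v + u j + (n : ℝ) • u o ∈ A \ edge A v u o := by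
  have hmem : v + u j + (n : ℝ) • u o ∈ A :=
    (h.add_smul_mem_iff hA (h.mem j) (h.coord_base hj) n).mpr (by rw [ht j hj]; omega)
  refine h.mem_sdiff_edge.mpr ⟨hmem, ?_⟩
  rw [← h.sum_erase_coord_add hj]
  exact sum_le_sum fun i _ => by rw [h.coord_add_nat_smul (h.mem j) hmem]; omega

theorem le_one_of_not_parallel (h : IsChart A v u c N) (hA : IsSegmentClosed Λ A)
    (ht : ∀ i, i ≠ o → #(lineFiber A (u o) (lineClass (u o) (v + u i))) = t i + 1)
    (hQ : #((A \ edge A v u o).image (lineClass y)) ≤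
      affRank ((A \ edge A v u o).image (lineClass y)) + 1)
    (hy : lineClass y (u o) ≠ 0) {j : ι} (hj : j ≠ o) : t j ≤ 1 := by
  by_contra! htj
  have hmem := fun n hn => mem_image_of_mem (lineClass y)
    (h.add_smul_mem_sdiff_edge hA ht hj (n := n) hn)
  have h1 := add_eq_add_of_card_le hQ (hmem 0 (by omega)) (hmem 2 htj) (hmem 1 (by omega))
    (hmem 1 (by omega)) (by rw [← map_add, ← map_add]; congr 1; push_cast; module)
  refine hy ?_
  have h2 : lineClass y (v + u j + ((0 : ℕ) : ℝ) • u o) =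
      lineClass y (v + u j + ((1 : ℕ) : ℝ) • u o) := by tauto
  simpa using h2

theorem lineClass_direction_eq (h : IsChart A v u c N) (hA : IsSegmentClosed Λ A)
    (ht : ∀ i, i ≠ o → #(lineFiber A (u o) (lineClass (u o) (v + u i))) = t i + 1)
    (hQ : #((A \ edge A v u o).image (lineClass y)) ≤
      affRank ((A \ edge A v u o).image (lineClass y)) + 1)
    (hy : lineClass y (u o) ≠ 0) {j k : ι} (hj : j ≠ o) (hk : k ≠ o) (htj : 1 ≤ t j)
    (htk : 1 ≤ t k) : lineClass y (u j) = lineClass y (u k) := by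
  have hmem := fun i hi n hn => mem_image_of_mem (lineClass y)
    (h.add_smul_mem_sdiff_edge hA ht (j := i) hi (n := n) hn)
  have h1 := add_eq_add_of_card_le hQ (hmem j hj 0 (by omega)) (hmem k hk 1 htk)
    (hmem k hk 0 (by omega)) (hmem j hj 1 htj)
    (by rw [← map_add, ← map_add]; congr 1; push_cast; module)
  rcases h1 with ⟨h1, -⟩ | ⟨h1, -⟩
  · simpa using h1
  · exact absurd (by simpa using h1) hy

theorem exists_smul_eq (h : IsChart A v u c N) {j k : ι} (hjk : j ≠ k)
    (hy : lineClass y (u j) = lineClass y (u k)) : ∃ s : ℝ, s ≠ 0 ∧ ∀ i,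
      s * c i y = (if i = j then 1 else 0) - (if i = k then 1 else 0) := by
  obtain ⟨s, hs⟩ := lineClass_eq_iff.mp hy
  have hc : ∀ i, s * c i y = (if i = j then 1 else 0) - (if i = k then 1 else 0) := fun i => by
    have := congrArg (c i) hs
    rw [map_add, map_smul, h.dual, h.dual, smul_eq_mul] at this
    linarith
  refine ⟨s, fun h0 => ?_, hc⟩
  have := hc j
  rw [if_pos rfl, if_neg hjk, h0] at this
  norm_num at this

theorem eq_of_lineClass_direction_eq (h : IsChart A v u c N) {j k l : ι} (hjk : j ≠ k)
    (hjl : j ≠ l) (hk : lineClass y (u j) = lineClass y (u k))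
    (hl : lineClass y (u j) = lineClass y (u l)) : k = l := by
  by_contra hkl
  obtain ⟨s, -, hs⟩ := h.exists_smul_eq hjk hk
  obtain ⟨s', hs'0, hs'⟩ := h.exists_smul_eq hjl hl
  have h1 := hs k
  have h2 := hs' k
  rw [if_neg (Ne.symm hjk), if_neg hkl, sub_zero, mul_eq_zero, or_iff_right hs'0] at h2
  rw [h2, if_neg (Ne.symm hjk), if_pos rfl] at h1
  norm_num at h1

theorem coord_eq_of_lineClass_eq (h : IsChart A v u c N) {j k : ι} (hjk : j ≠ k)
    (hy : lineClass y (u j) = lineClass y (u k)) {x z : V} (hx : x ∈ A) (hz : z ∈ A)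
    (hxz : lineClass y x = lineClass y z) :
    (∀ i, i ≠ j → i ≠ k → N x i = N z i) ∧ N x j + N x k = N z j + N z k := by
  obtain ⟨s, hs0, hs⟩ := h.exists_smul_eq hjk hy
  obtain ⟨τ, hτ⟩ := lineClass_eq_iff.mp hxz
  have hc : ∀ i, (N x i : ℝ) = N z i + τ * c i y := fun i => by
    have := congrArg (c i) hτ
    rw [map_add, map_smul, h.apply_eq hx, h.apply_eq hz, smul_eq_mul] at this
    linarith
  constructor
  · intro i hij hik
    have h1 := hs i
    rw [if_neg hij, if_neg hik, sub_zero, mul_eq_zero, or_iff_right hs0] at h1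
    have h2 := hc i
    rw [h1, mul_zero, add_zero] at h2
    exact_mod_cast h2
  · have h1 : s * (c j y + c k y) = 0 := by
      rw [mul_add, hs, hs]
      simp [hjk, hjk.symm]
    rw [mul_eq_zero, or_iff_right hs0] at h1
    have h2 : (N x j + N x k : ℝ) = N z j + N z k := by
      rw [hc, hc k]
      linear_combination τ * h1
    exact_mod_cast h2

theorem card_lineFiber_le (h : IsChart A v u c N) {B : Finset V} (hB : B ⊆ A) {j k : ι}
    (hjk : j ≠ k) (hy : lineClass y (u j) = lineClass y (u k)) {x : V} (hx : x ∈ A) :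
    #(lineFiber B y (lineClass y x)) ≤ N x j + N x k + 1 := by
  rw [← card_range (N x j + N x k + 1)]
  refine card_le_card_of_injOn (fun z => N z j) ?_ ?_
  · intro z hz
    obtain ⟨hzB, hzx⟩ := mem_lineFiber.mp hz
    have := (h.coord_eq_of_lineClass_eq hjk hy (hB hzB) hx hzx).2
    simp only [coe_range, Set.mem_Iio]
    omega
  · intro z hz w hw hzw
    obtain ⟨hzB, hzx⟩ := mem_lineFiber.mp hz
    obtain ⟨hwB, hwx⟩ := mem_lineFiber.mp hw
    obtain ⟨h1, h2⟩ := h.coord_eq_of_lineClass_eq hjk hy (hB hzB) (hB hwB) (hzx.trans hwx.symm)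
    refine h.ext (hB hzB) (hB hwB) fun i => ?_
    by_cases hij : i = j
    · exact hij ▸ hzw
    by_cases hik : i = k
    · subst hik
      have : N z j = N w j := hzw
      omega
    · exact h1 i hij hik

theorem exists_representatives (h : IsChart A v u c N) (hA : IsSegmentClosed Λ A)
    (ht : ∀ i, i ≠ o → #(lineFiber A (u o) (lineClass (u o) (v + u i))) = t i + 1) {j k : ι}
    (hj : j ≠ o) (hk : k ≠ o) (hjk : j ≠ k) (htj : 1 ≤ t j) (i : ι) (hik : i ≠ k) :
    ∃ x ∈ A \ edge A v u o, (∀ l, l ≠ j → l ≠ k → N x l = if l = i then 1 else 0) ∧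
      N x j + N x k = (if i = j then 1 else 0) + if i = o then 1 else 0 := by
  by_cases hio : i = o
  · subst hio
    have hmem := h.add_smul_mem_sdiff_edge hA ht hj htj
    refine ⟨_, hmem, fun l hlj hlk => ?_, ?_⟩
    · rw [h.coord_add_nat_smul (h.mem j) (mem_sdiff.mp hmem).1, h.coord_add, if_neg hlj, zero_add]
    · rw [h.coord_add_nat_smul (h.mem j) (mem_sdiff.mp hmem).1,
        h.coord_add_nat_smul (h.mem j) (mem_sdiff.mp hmem).1, h.coord_add, h.coord_add]
      simp [hj, hk, hj.symm, hjk.symm]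
  · refine ⟨_, h.add_mem_sdiff_edge hio, fun l hlj hlk => h.coord_add i l, ?_⟩
    rw [h.coord_add, h.coord_add, if_neg hio, if_neg (Ne.symm hik), add_zero, add_zero]
    simp only [eq_comm]

theorem coord_pair_le_two (h : IsChart A v u c N) {j k : ι} (hjk : j ≠ k)
    (hclass : ∀ x ∈ A, ∀ z ∈ A, 2 ≤ N x j + N x k → 2 ≤ N z j + N z k →
      (∀ i, i ≠ j → i ≠ k → N x i = N z i) ∧ N x j + N x k = N z j + N z k)
    {x : V} (hx : x ∈ A) : N x j + N x k ≤ 2 := by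
  by_contra! h3
  obtain ⟨a, ha, b, hb, hav, hbv, hab⟩ := h.exists_add_eq x hx
    (fun hxv => by rw [hxv, h.coord_origin, h.coord_origin] at h3; omega)
    (fun i hxi => by rw [hxi, h.coord_add, h.coord_add] at h3; split_ifs at h3 <;> omega)
  have key : ∀ a ∈ A, ∀ b ∈ A, b ≠ v → a + b = v + x → N a j + N a k < 2 := by
    intro a ha b hb hbv hab
    by_contra! h2
    have hs := h.add_eq ha hb h.origin_mem hx hab
    simp only [h.coord_origin, zero_add] at hs
    obtain ⟨h4, h5⟩ := hclass a ha x hx h2 (by omega)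
    refine hbv (h.ext hb h.origin_mem fun i => ?_)
    rw [h.coord_origin]
    have := hs i
    have := hs j
    have := hs k
    by_cases hij : i = j
    · subst hij; omega
    by_cases hik : i = k
    · subst hik; omega
    have := h4 i hij hik
    omega
  have hs := h.add_eq ha hb h.origin_mem hx hab
  have hsj := hs j
  have hsk := hs k
  rw [h.coord_origin, zero_add] at hsj hsk
  have := key a ha b hb hbv hab
  have := key b hb a ha hav (by rw [add_comm]; exact hab)
  omega

theorem card_sdiff_edge_le (h : IsChart A v u c N) (hA : IsSegmentClosed Λ A)
    (ht : ∀ i, i ≠ o → #(lineFiber A (u o) (lineClass (u o) (v + u i))) = t i + 1) {j k : ι}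
    (hj : j ≠ o) (hk : k ≠ o) (hjk : j ≠ k) (htj : 1 ≤ t j)
    (hy : lineClass y (u j) = lineClass y (u k))
    (hcov : #((A \ edge A v u o).image (lineClass y)) ≤ affRank A) :
    #(A \ edge A v u o) ≤ affRank A + 4 := by
  have hBA : A \ edge A v u o ⊆ A := sdiff_subset
  choose! g hg using h.exists_representatives hA ht hj hk hjk htj
  have hinj : Set.InjOn (fun i => lineClass y (g i)) (univ.erase k : Finset ι) := by
    have key : ∀ i, i ≠ k → ∀ l, l ≠ k → lineClass y (g i) = lineClass y (g l) → i ≠ j →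
        i = l := by
      intro i hi l hl hil hij
      by_contra hne
      have h1 := (h.coord_eq_of_lineClass_eq hjk hy (hBA (hg i hi).1) (hBA (hg l hl).1) hil).1
        i hij hi
      rw [(hg i hi).2.1 i hij hi, (hg l hl).2.1 i hij hi, if_pos rfl, if_neg hne] at h1
      omega
    intro i hi l hl hil
    have hi' : i ≠ k := ne_of_mem_erase hi
    have hl' : l ≠ k := ne_of_mem_erase hl
    by_cases hij : i = j
    · by_cases hlj : l = j
      · rw [hij, hlj]
      · exact (key l hl' i hi' hil.symm hlj).symm
    · exact key i hi' l hl' hil hij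
  set Q := (A \ edge A v u o).image (lineClass y) with hQ
  set K := (univ.erase k).image fun i => lineClass y (g i) with hK
  have hKQ : K ⊆ Q := by
    intro p hp
    obtain ⟨i, hi, rfl⟩ := mem_image.mp hp
    exact mem_image_of_mem _ (hg i (ne_of_mem_erase hi)).1
  have hKcard : #K + 1 = affRank A := by
    rw [hK, card_image_of_injOn hinj, h.card_erase_eq]
  have hdiff : #(Q \ K) ≤ 1 := by
    rw [card_sdiff_of_subset hKQ]
    omega
  have hnotK : ∀ x ∈ A, 2 ≤ N x j + N x k → lineClass y x ∈ Q \ K := by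
    intro x hx hx2
    refine mem_sdiff.mpr ⟨mem_image_of_mem _ (h.mem_sdiff_edge.mpr ⟨hx, ?_⟩), fun hxK => ?_⟩
    · by_contra! h0
      have h0' := sum_eq_zero_iff.mp (Nat.lt_one_iff.mp h0)
      rw [h0' j (mem_erase.mpr ⟨hj, mem_univ _⟩), h0' k (mem_erase.mpr ⟨hk, mem_univ _⟩)] at hx2
      omega
    · obtain ⟨i, hi, hix⟩ := mem_image.mp hxK
      have hi := ne_of_mem_erase hi
      have h1 := (h.coord_eq_of_lineClass_eq hjk hy (hBA (hg i hi).1) hx hix).2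
      have h2 := (hg i hi).2.2
      by_cases hij : i = j
      · rw [if_pos hij, if_neg (hij ▸ hj)] at h2
        omega
      · rw [if_neg hij] at h2
        split_ifs at h2 <;> omega
  have htwo : ∀ x ∈ A, N x j + N x k ≤ 2 := fun x hx => h.coord_pair_le_two hjk
    (fun a ha b hb ha2 hb2 => h.coord_eq_of_lineClass_eq hjk hy ha hb
      (card_le_one.mp hdiff _ (hnotK a ha ha2) _ (hnotK b hb hb2))) hx
  have hsumK : ∑ p ∈ K, #(lineFiber (A \ edge A v u o) y p) ≤ affRank A + 1 := by
    rw [hK, sum_image hinj]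
    calc ∑ i ∈ univ.erase k, #(lineFiber (A \ edge A v u o) y (lineClass y (g i)))
        ≤ ∑ i ∈ univ.erase k, ((if i = j then 1 else 0) + (if i = o then 1 else 0) + 1) :=
          sum_le_sum fun i hi => by
            rw [← (hg i (ne_of_mem_erase hi)).2.2]
            exact h.card_lineFiber_le hBA hjk hy (hBA (hg i (ne_of_mem_erase hi)).1)
      _ = affRank A + 1 := by
          rw [sum_add_distrib, sum_add_distrib, sum_ite_eq', sum_ite_eq', sum_const, smul_eq_mul,
            ← h.card_erase_eq k, if_pos (by simp [hjk]), if_pos (by simp [hk.symm])]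
          ring
  have hsumQ : ∑ p ∈ Q \ K, #(lineFiber (A \ edge A v u o) y p) ≤ 3 := by
    refine (sum_le_card_nsmul _ _ 3 fun p hp => ?_).trans (by rw [smul_eq_mul]; omega)
    obtain ⟨x, hx, rfl⟩ := mem_image.mp (mem_sdiff.mp hp).1
    have := htwo x (hBA hx)
    exact (h.card_lineFiber_le hBA hjk hy (hBA hx)).trans (by omega)
  have := sum_sdiff (f := fun p => #(lineFiber (A \ edge A v u o) y p)) hKQ
  rw [sum_card_lineFiber] at this
  omega

theorem false_of_not_parallel (h : IsChart A v u c N) (hA : IsSegmentClosed Λ A) (hm1 : 1 ≤ m)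
    (hm : #(lineFiber A (u o) (lineClass (u o) v)) = m + 1)
    (ht : ∀ i, i ≠ o → #(lineFiber A (u o) (lineClass (u o) (v + u i))) = t i + 1)
    (hle : ∀ x ∈ A, N x o + ∑ i ∈ univ.erase o, m * N x i ≤ m + ∑ i ∈ univ.erase o, t i * N x i)
    (htm : ∀ i, i ≠ o → m ≤ t i + 1) (hexc : 3 * doublingExcess A + 8 ≤ 2 * surplus A)
    (hT : m + 4 ≤ 3 * ∑ i ∈ univ.erase o, t i)
    (hr : affRank (A \ edge A v u o) = affRank A)
    (hcov : #((A \ edge A v u o).image (lineClass y)) ≤ affRank (A \ edge A v u o))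
    (hy : lineClass y (u o) ≠ 0) : False := by
  have hQ := hcov.trans (affRank_le_affRank_image_add_one _ y)
  have ht1 : ∀ i, i ≠ o → t i ≤ 1 := fun i hi => h.le_one_of_not_parallel hA ht hQ hy hi
  have hsum : ∑ i ∈ univ.erase o, t i = #{i ∈ univ.erase o | 1 ≤ t i} := by
    rw [card_filter]
    refine sum_congr rfl fun i hi => ?_
    have := ht1 i (ne_of_mem_erase hi)
    split_ifs <;> omega
  have hcard : #{i ∈ univ.erase o | 1 ≤ t i} ≤ 2 := by
    by_contra! h3
    obtain ⟨j, hj, k, hk, l, hl, hjk, hjl, hkl⟩ := two_lt_card.mp h3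
    simp only [mem_filter, mem_erase, mem_univ, and_true] at hj hk hl
    exact hkl (h.eq_of_lineClass_direction_eq hjk hjl
      (h.lineClass_direction_eq hA ht hQ hy hj.1 hk.1 hj.2 hk.2)
      (h.lineClass_direction_eq hA ht hQ hy hj.1 hl.1 hj.2 hl.2))
  obtain ⟨j, k, hjk, hfil⟩ := card_eq_two.mp (show #{i ∈ univ.erase o | 1 ≤ t i} = 2 by omega)
  have hj : j ∈ ({i ∈ univ.erase o | 1 ≤ t i} : Finset ι) := hfil ▸ by simp
  have hk : k ∈ ({i ∈ univ.erase o | 1 ≤ t i} : Finset ι) := hfil ▸ by simp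
  simp only [mem_filter, mem_erase, mem_univ, and_true] at hj hk
  have hexcB := h.doublingExcess_sdiff_edge ht hr
  have hBne : (A \ edge A v u o).Nonempty := ⟨_, h.add_mem_sdiff_edge hj.1⟩
  have hB0 := doublingExcess_nonneg hBne
  have hsum2 : ∑ i ∈ univ.erase o, t i = 2 := by omega
  rw [hsum2] at hexcB
  push_cast at hexcB
  have hs : (7 : ℤ) ≤ surplus A := by linarith
  unfold surplus at hs
  obtain rfl | rfl : m = 1 ∨ m = 2 := by omega
  · have h1 := h.card_sdiff_edge_le hA ht hj.1 hk.1 hjk hj.2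
      (h.lineClass_direction_eq hA ht hQ hy hj.1 hk.1 hj.2 hk.2) (hr ▸ hcov)
    have h2 := card_sdiff_edge_add A v u o
    rw [edge, hm] at h2
    unfold edge at h1
    omega
  · have hall : univ.erase o = ({j, k} : Finset ι) := by
      rw [← hfil, filter_true_of_mem]
      intro i hi
      have := htm i (ne_of_mem_erase hi)
      omega
    have hrk := h.card_erase_eq o
    rw [hall, card_pair hjk] at hrk
    have hAle := h.card_le_choose (sum_coord_le hle fun i hi => by
      have := htm i hi
      have := ht1 i hi
      omega)
    rw [← hrk] at hAle
    norm_num [Nat.choose] at hAle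
    omega

end IsChart

theorem IsSegmentClosed.erase {Λ : AddSubgroup V} {A : Finset V} (hA : IsSegmentClosed Λ A) {v : V}
    (hv : IsVertex A v) : IsSegmentClosed Λ (A.erase v) := by
  refine ⟨fun x hx => hA.1 x (mem_of_mem_erase hx), fun x hx y hy z hz hzs => ?_⟩
  refine mem_erase.mpr ⟨?_, hA.2 x (mem_of_mem_erase hx) y (mem_of_mem_erase hy) z hz hzs⟩
  obtain ⟨-, f, hf⟩ := hv
  have hx := hf x (mem_of_mem_erase hx) (ne_of_mem_erase hx)
  have hy := hf y (mem_of_mem_erase hy) (ne_of_mem_erase hy)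
  obtain ⟨a, b, ha, hb, hab, rfl⟩ := hzs
  intro h
  have h1 := congrArg f h
  rw [map_add, map_smul, map_smul, smul_eq_mul, smul_eq_mul] at h1
  have h2 : a * (f x - f v) + b * (f y - f v) = 0 := by
    linear_combination h1 - f v * hab
  rcases ha.eq_or_lt with rfl | ha
  · rw [zero_add] at hab
    subst hab
    linarith
  · have := mul_pos ha (sub_pos.mpr hx)
    have := mul_nonneg hb (sub_pos.mpr hy).le
    linarith

namespace IsChart

variable {Λ : AddSubgroup V} {A : Finset V} {v : V} {ι : Type*} [Fintype ι] {u : ι → V}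
  {c : ι → V →ₗ[ℝ] ℝ} {N : V → ι → ℕ}

theorem coveredByLines_of_minimal_edge (h : IsChart A v u c N) (hA : IsSegmentClosed Λ A)
    (hexc : 3 * doublingExcess A + 8 ≤ 2 * surplus A)
    (hexcep : ¬(surplus A = 7 ∧ doublingExcess A = 2))
    (hirr : ∀ w, IsVertex A w → #(irreducibles A w) = affRank A) (o : ι)
    (hmin : ∀ i, #(lineFiber A (u o) (lineClass (u o) v)) ≤
      #(lineFiber A (u i) (lineClass (u i) v)))
    (ih : 3 * doublingExcess (A \ edge A v u o) + 8 ≤ 2 * surplus (A \ edge A v u o) →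
      ¬(surplus (A \ edge A v u o) = 7 ∧ doublingExcess (A \ edge A v u o) = 2) →
      CoveredByLines (A \ edge A v u o)) : CoveredByLines A := by
  by_contra hnc
  obtain ⟨m, hm⟩ : ∃ m, #(lineFiber A (u o) (lineClass (u o) v)) = m + 1 :=
    Nat.exists_eq_add_one.mpr (card_pos.mpr ⟨v, mem_lineFiber.mpr ⟨h.origin_mem, rfl⟩⟩)
  have hm1 : 1 ≤ m := by
    have := (h.add_smul_mem_iff hA h.origin_mem (h.coord_origin o) 1).mp
      (by rw [Nat.cast_one, one_smul]; exact h.mem o)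
    omega
  choose t ht' using fun i => Nat.exists_eq_add_one.mpr
    (card_pos.mpr ⟨v + u i, mem_lineFiber.mpr ⟨h.mem i, rfl⟩⟩ :
      0 < #(lineFiber A (u o) (lineClass (u o) (v + u i))))
  have ht : ∀ i, i ≠ o → _ := fun i _ => ht' i
  have hle : ∀ x ∈ A, _ := fun x hx =>
    h.coord_add_le hA hm ht (hirr _ (h.isVertex_opposite hA hm)) hx
  have htm : ∀ i, i ≠ o → m ≤ t i + 1 := fun i hi => by
    rw [← ht i hi]
    refine h.le_card_lineFiber hA hi (h.opposite_mem hA hm) ?_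
    rw [h.add_smul_mem_iff hA h.origin_mem (h.coord_origin i)]
    have := hmin i
    omega
  have hT := h.not_sum_lt hA hnc hm1 ht hle htm hexc hexcep
  obtain ⟨j, hj, htj⟩ := exists_ne_zero_of_sum_ne_zero
    (show ∑ i ∈ univ.erase o, t i ≠ 0 by omega)
  have hr := h.affRank_sdiff_edge hA hnc (ne_of_mem_erase hj) (by rw [ht']; omega)
  have hexcB := h.doublingExcess_sdiff_edge ht hr
  have hsB := surplus_sdiff_edge hr
  rw [show #(edge A v u o) = m + 1 from hm] at hsB
  have hT' : (m : ℤ) + 4 ≤ 3 * (∑ i ∈ univ.erase o, t i : ℕ) := by exact_mod_cast hT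
  have hcovB := ih (by push_cast at hexcB hsB hT'; linarith)
    (h.not_exception hA hm ht hle htm hexc hT hr)
  obtain ⟨y, hstep, hcov⟩ := hcovB.exists_isStep (h.isSegmentClosed_sdiff_edge hA o)
  exact h.false_of_not_parallel hA hm1 hm ht hle htm hexc hT hr hcov
    (h.not_parallel hnc hexc hr hstep hcov)

end IsChart

theorem coveredByLines_of_erase {Λ : AddSubgroup V} {A : Finset V} {v : V} (hv : IsVertex A v)
    (hA : IsSegmentClosed Λ A) (hne : (A.erase v).Nonempty)
    (hexc : 3 * doublingExcess A + 8 ≤ 2 * surplus A)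
    (hexcep : ¬(surplus A = 7 ∧ doublingExcess A = 2))
    (hirr : affRank (A.erase v) < affRank A ∨ affRank A < #(irreducibles A v))
    (ih : 3 * doublingExcess (A.erase v) + 8 ≤ 2 * surplus (A.erase v) →
      ¬(surplus (A.erase v) = 7 ∧ doublingExcess (A.erase v) = 2) →
      CoveredByLines (A.erase v)) : CoveredByLines A := by
  have hinsert : ∀ y : V, A.image (lineClass y) =
      insert (lineClass y v) ((A.erase v).image (lineClass y)) := fun y => by
    rw [← image_insert, insert_erase hv.1]
  rcases (affRank_mono (erase_subset v A)).lt_or_eq with hr | hr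
  · obtain ⟨h1, h2⟩ := doublingExcess_erase_of_affRank_lt hv hne hr
    obtain ⟨y, hy, hcov⟩ := ih (by linarith) (by rintro ⟨h3, h4⟩; omega)
    refine ⟨y, hy, ?_⟩
    rw [hinsert]
    exact (card_insert_le _ _).trans (by omega)
  · have h1 := doublingExcess_erase_of_affRank_eq hv hr
    have h2 : surplus (A.erase v) = surplus A - 1 := by
      have := card_erase_add_one hv.1
      unfold surplus
      rw [hr, ← this]
      push_cast
      ring
    rw [or_iff_right hr.not_lt] at hirr
    have h3 : (affRank A : ℤ) + 1 ≤ #(irreducibles A v) := by exact_mod_cast hirr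
    obtain ⟨y, hstep, hcov⟩ := (ih (by linarith) (by rintro ⟨h4, h5⟩; omega)).exists_isStep
      (hA.erase hv)
    by_cases hq : lineClass y v ∈ (A.erase v).image (lineClass y)
    · exact ⟨y, hstep.1, by rwa [hinsert, insert_eq_of_mem hq, ← hr]⟩
    · obtain ⟨f, hf⟩ := hv.2
      have hU : {v} ∪ A.erase v = A := by rw [← insert_eq, insert_erase hv.1]
      have := two_mul_surplus_lt_of_split (E := {v}) hstep (singleton_nonempty v) hne
        (fun x hx => by rw [mem_singleton.mp hx]) hq hcov (by rw [hU, hr]) f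
        (fun x hx => by rw [mem_singleton.mp hx])
        (fun x hx => hf x (mem_of_mem_erase hx) (ne_of_mem_erase hx)) (Or.inl (card_singleton v))
      rw [hU] at this
      linarith

theorem coveredByLines_of_doublingExcess_le {Λ : AddSubgroup V} {A : Finset V} (hne : A.Nonempty)
    (hA : IsSegmentClosed Λ A) (hexc : 3 * doublingExcess A + 8 ≤ 2 * surplus A)
    (hexcep : ¬(surplus A = 7 ∧ doublingExcess A = 2)) : CoveredByLines A := by
  induction A using Finset.strongInduction with
  | H A ih =>
  have h5 : 5 ≤ #A := by
    have := doublingExcess_nonneg hne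
    have hs : 4 ≤ surplus A := by linarith
    unfold surplus at hs
    omega
  by_cases hirr : ∃ v, IsVertex A v ∧
      (affRank (A.erase v) < affRank A ∨ affRank A < #(irreducibles A v))
  · obtain ⟨v, hv, hirr⟩ := hirr
    have hne' : (A.erase v).Nonempty := card_pos.mp (by rw [card_erase_of_mem hv.1]; omega)
    exact coveredByLines_of_erase hv hA hne' hexc hexcep hirr
      (ih _ (erase_ssubset hv.1) hne' (hA.erase hv))
  push Not at hirr
  have hirr : ∀ w, IsVertex A w → #(irreducibles A w) = affRank A := fun w hw =>
    le_antisymm (hirr w hw).2 (affRank_le_card_irreducibles hw)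
  set S := {p ∈ A ×ˢ A | IsVertex A p.1 ∧ p.2 ∈ irreducibles A p.1} with hS
  have hSne : S.Nonempty := by
    obtain ⟨v, hv⟩ := exists_isVertex hne
    obtain ⟨x, hx, hxv⟩ := exists_mem_ne (by omega : 1 < #A) v
    by_contra hemp
    have hempty : IsEmpty (irreducibles A v) := ⟨fun w => hemp ⟨(v, w), mem_filter.mpr
      ⟨mem_product.mpr ⟨hv.1, (mem_irreducibles.mp w.2).1⟩, hv, w.2⟩⟩⟩
    obtain ⟨N, hN⟩ := exists_nat_combination hv hx
    rw [univ_eq_empty, sum_empty, add_zero] at hN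
    exact hxv hN
  obtain ⟨⟨v, w⟩, hvw, hmin⟩ := exists_min_image S
    (fun p => #(lineFiber A (p.2 - p.1) (lineClass (p.2 - p.1) p.1))) hSne
  obtain ⟨-, hv, hw⟩ := mem_filter.mp hvw
  obtain ⟨c, N, h⟩ := exists_isChart hv (hirr v hv)
  refine h.coveredByLines_of_minimal_edge hA hexc hexcep hirr ⟨w, hw⟩
    (fun i => hmin (v, i) (mem_filter.mpr
      ⟨mem_product.mpr ⟨hv.1, (mem_irreducibles.mp i.2).1⟩, hv, i.2⟩)) ?_
  intro h1 h2
  have hpos : 0 < #(A \ IsChart.edge A v (fun w : irreducibles A v => (w : V) - v) ⟨w, hw⟩) := by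
    by_contra h0
    rw [Nat.pos_iff_ne_zero, not_not, card_eq_zero] at h0
    rw [h0] at h1
    simp only [doublingExcess, surplus, empty_add, card_empty] at h1
    push_cast at h1
    nlinarith [Int.natCast_nonneg (affRank (∅ : Finset V))]
  refine ih _ ?_ (card_pos.mp hpos) (h.isSegmentClosed_sdiff_edge hA _) h1 h2
  exact sdiff_ssubset (IsChart.edge_subset _)
    ⟨v, mem_lineFiber.mpr ⟨h.origin_mem, rfl⟩⟩

/-- The points of `A` fill the lines `b i + ℝ • y`, the `i`-th of them in `a i + 1` consecutive
points, and the functionals `l i` separate the lines. -/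
structure IsLineChart (A : Finset V) (y : V) {ι : Type*} [Fintype ι] (b : ι → V) (a : ι → ℕ)
    (l : ι → V →ₗ[ℝ] ℝ) (c : ι → ℝ) : Prop where
  card_eq : Fintype.card ι = affRank A
  ne_zero : y ≠ 0
  mem : ∀ i k, k ≤ a i → b i + (k : ℝ) • y ∈ A
  exists_eq : ∀ x ∈ A, ∃ i k, k ≤ a i ∧ x = b i + (k : ℝ) • y
  sum_eq : ∑ i, (a i + 1) = #A
  apply_base : ∀ i j, l i (b j) = c i + if i = j then 1 else 0
  apply_direction : ∀ i, l i y = 0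

theorem exists_isLineChart {A : Finset V} (hA : A.Nonempty) {y : V} (hy : IsStep A y)
    (hcov : #(A.image (lineClass y)) ≤ affRank A) :
    ∃ b a l c, IsLineChart A y (ι := A.image (lineClass y)) b a l c := by
  choose b hb using fun p : A.image (lineClass y) => hy.lineFiber_eq p.2
  choose a ha using fun p : A.image (lineClass y) =>
    Nat.exists_eq_add_one.mpr (card_pos.mpr (lineFiber_nonempty p.2))
  choose l c hl hc using fun p : A.image (lineClass y) => exists_separating_of_card_le
    (hcov.trans (affRank_le_affRank_image_add_one A y)) p.2
  have hmem : ∀ p k, k ≤ a p → b p + (k : ℝ) • y ∈ lineFiber A y p := fun p k hk => by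
    rw [hb, ha]
    exact mem_image.mpr ⟨k, mem_range.mpr (by omega), rfl⟩
  refine ⟨b, a, fun p => (l p).comp (lineClass y), c, ?_, hy.1, fun p k hk => ?_, fun x hx => ?_,
    ?_, fun p q => ?_, fun p => ?_⟩
  · rw [Fintype.card_coe]
    exact le_antisymm hcov (affRank_le_card_image hA y)
  · exact (mem_lineFiber.mp (hmem p k hk)).1
  · have hxm : x ∈ lineFiber A y (lineClass y x) := mem_lineFiber.mpr ⟨hx, rfl⟩
    have := hb ⟨lineClass y x, mem_image_of_mem _ hx⟩
    rw [ha] at this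
    rw [this] at hxm
    obtain ⟨k, hk, hkx⟩ := mem_image.mp hxm
    exact ⟨_, k, Nat.lt_succ_iff.mp (mem_range.mp hk), hkx.symm⟩
  · exact (sum_congr rfl fun p _ => (ha p).symm).trans
      ((sum_coe_sort (A.image (lineClass y)) fun p => #(lineFiber A y p)).trans
        (sum_card_lineFiber A y))
  · have h0 := (mem_lineFiber.mp (hmem q 0 (Nat.zero_le _))).2
    rw [Nat.cast_zero, zero_smul, add_zero] at h0
    rw [LinearMap.comp_apply, h0]
    by_cases hpq : p = q
    · rw [if_pos hpq, ← hpq, hl]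
    · rw [if_neg hpq, hc p q q.2 (fun h => hpq (Subtype.ext h.symm)), add_zero]
  · have : lineClass y y = 0 := by
      rw [← map_zero (lineClass y), lineClass_eq_iff]
      exact ⟨1, by simp⟩
    rw [LinearMap.comp_apply, this, map_zero]

theorem IsStep.exists_int_eq {Λ : AddSubgroup V} {A : Finset V} (hA : IsSegmentClosed Λ A) {y : V}
    (hy : IsStep A y) {x : V} (hx : x ∈ A) (hxy : x + y ∈ A) {s : ℝ} (hs : s • y ∈ Λ) :
    ∃ z : ℤ, s = z := by
  have hyΛ : y ∈ Λ := by simpa using Λ.sub_mem (hA.1 _ hxy) (hA.1 _ hx)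
  have hfract : Int.fract s • y ∈ Λ := by
    rw [Int.fract, sub_smul, Int.cast_smul_eq_zsmul]
    exact Λ.sub_mem hs (Λ.zsmul_mem hyΛ _)
  have hmem : x + Int.fract s • y ∈ A := by
    refine hA.2 x hx _ hxy _ (Λ.add_mem (hA.1 x hx) hfract) ?_
    have := mem_segment_add_smul (x := x) (y := y) (Int.fract_nonneg s) (Int.fract_lt_one s).le
    rwa [one_smul] at this
  obtain ⟨n, hn⟩ := (hy.2 x hx _ (Int.fract_nonneg s) hmem).1
  have hlt := Int.fract_lt_one s
  rw [hn] at hlt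
  have hn0 : n = 0 := by exact_mod_cast Nat.lt_one_iff.mp (by exact_mod_cast hlt)
  refine ⟨⌊s⌋, ?_⟩
  have := Int.floor_add_fract s
  rw [hn, hn0, Nat.cast_zero, add_zero] at this
  exact this.symm

theorem sum_finsuppAntidiag_apply {ι : Type*} [Fintype ι] {q : ℕ} (hq : Fintype.card ι = q + 1)
    (k : ℕ) (i : ι) :
    ∑ f ∈ (univ : Finset ι).finsuppAntidiag k, f i = (q + k).choose (q + 1) := by
  have hsymm : ∀ j, ∑ f ∈ (univ : Finset ι).finsuppAntidiag k, f j =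
      ∑ f ∈ (univ : Finset ι).finsuppAntidiag k, f i := fun j => by
    refine sum_equiv (Finsupp.domCongr (Equiv.swap i j)).toEquiv (fun f => ?_) fun f _ => ?_
    · simp only [mem_finsuppAntidiag, subset_univ, and_true]
      rw [← Equiv.sum_comp (Equiv.swap i j).symm]
      rfl
    · simp
  have hcard := card_finsuppAntidiag_nat_eq_choose (s := (univ : Finset ι)) k
  rw [card_univ, hq, show q + 1 + k - 1 = q + k by omega] at hcard
  have htot : ∑ j : ι, ∑ f ∈ (univ : Finset ι).finsuppAntidiag k, f j = (q + k).choose k * k := by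
    rw [sum_comm, ← hcard, ← smul_eq_mul]
    exact sum_const_nat fun f hf => (mem_finsuppAntidiag.mp hf).1
  rw [sum_congr rfl fun j _ => hsymm j, sum_const, card_univ, hq, smul_eq_mul] at htot
  have h1 := Nat.choose_succ_right_eq (q + k) q
  rw [Nat.add_sub_cancel_left, Nat.choose_symm_add] at h1
  exact Nat.eq_of_mul_eq_mul_left (Nat.succ_pos q) (by rw [htot, ← h1, mul_comm])

/-- The points of the `k`-fold dilation of the convex hull of a line chart which lie on the
lines through the `k`-fold sums of the points `b i`, at integral distance from these sums. -/
noncomputable def lineSums (y : V) {ι : Type*} [Fintype ι] (b : ι → V) (a : ι → ℕ) (k : ℕ) :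
    Finset V :=
  (((univ : Finset ι).finsuppAntidiag k).sigma fun f => range (∑ i, f i * a i + 1)).image
    fun p => ∑ i, (p.1 i : ℝ) • b i + (p.2 : ℝ) • y

theorem mem_lineSums {y : V} {ι : Type*} [Fintype ι] {b : ι → V} {a : ι → ℕ} {k : ℕ} {x : V} :
    x ∈ lineSums y b a k ↔ ∃ f : ι → ℕ, ∑ i, f i = k ∧ ∃ t ≤ ∑ i, f i * a i,
      x = ∑ i, (f i : ℝ) • b i + (t : ℝ) • y := by
  constructor
  · intro hx
    obtain ⟨⟨f, t⟩, hft, rfl⟩ := mem_image.mp hx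
    obtain ⟨hf, ht⟩ := mem_sigma.mp hft
    exact ⟨f, (mem_finsuppAntidiag.mp hf).1, t, Nat.lt_succ_iff.mp (mem_range.mp ht), rfl⟩
  · rintro ⟨f, hf, t, ht, rfl⟩
    refine mem_image.mpr ⟨⟨Finsupp.equivFunOnFinite.symm f, t⟩, mem_sigma.mpr ⟨?_, ?_⟩, rfl⟩
    · exact mem_finsuppAntidiag.mpr ⟨hf, subset_univ _⟩
    · exact mem_range.mpr (Nat.lt_succ_iff.mpr ht)

namespace IsLineChart

variable {Λ : AddSubgroup V} {A : Finset V} {y : V} {ι : Type*} [Fintype ι] {b : ι → V} {a : ι → ℕ}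
  {l : ι → V →ₗ[ℝ] ℝ} {c : ι → ℝ}

theorem apply_sum (h : IsLineChart A y b a l c) (μ : ι → ℝ) (s : ℝ) (i : ι) :
    l i (∑ j, μ j • b j + s • y) = (∑ j, μ j) * c i + μ i := by
  simp [h.apply_base, h.apply_direction, mul_add, sum_add_distrib, sum_mul]

theorem card_lineSums (h : IsLineChart A y b a l c) {q s : ℕ} (hq : affRank A = q + 1)
    (hs : #A = q + 1 + 1 + s) (k : ℕ) :
    #(lineSums y b a k) = (q + 1 + k).choose (q + 1) + s * (q + k).choose (q + 1) := by
  have hι : Fintype.card ι = q + 1 := h.card_eq.trans hq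
  rw [lineSums, card_image_of_injOn, card_sigma]
  · simp only [card_range, sum_add_distrib, sum_const, smul_eq_mul, mul_one]
    rw [sum_comm]
    simp only [← sum_mul, sum_finsuppAntidiag_apply hι]
    have hcard := card_finsuppAntidiag_nat_eq_choose (s := (univ : Finset ι)) k
    rw [card_univ, hι, show q + 1 + k - 1 = q + k by omega] at hcard
    have hsum := h.sum_eq
    rw [sum_add_distrib, sum_const, card_univ, hι, hs, smul_eq_mul, mul_one] at hsum
    rw [hcard, ← mul_sum, show ∑ i, a i = s + 1 by omega, show q + 1 + k = q + k + 1 by ring,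
      Nat.choose_succ_succ, Nat.choose_symm_add]
    ring
  · rintro ⟨f, t⟩ hf ⟨g, w⟩ hg hfg
    obtain ⟨hf, -⟩ := mem_sigma.mp hf
    obtain ⟨hg, -⟩ := mem_sigma.mp hg
    have hf : (∑ i, (f i : ℝ)) = k := by exact_mod_cast (mem_finsuppAntidiag.mp hf).1
    have hg : (∑ i, (g i : ℝ)) = k := by exact_mod_cast (mem_finsuppAntidiag.mp hg).1
    obtain rfl : f = g := by
      ext i
      have h1 := congrArg (l i) hfg
      simp only [h.apply_sum, hf, hg, add_right_inj] at h1
      exact_mod_cast h1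
    simp only [add_right_inj] at hfg
    have := smul_left_injective ℝ h.ne_zero hfg
    simp only [Nat.cast_inj] at this
    rw [this]

theorem exists_of_mem_convexHull (h : IsLineChart A y b a l c) {x : V}
    (hx : x ∈ convexHull ℝ (A : Set V)) : ∃ μ : ι → ℝ, (∀ i, 0 ≤ μ i) ∧ ∑ i, μ i = 1 ∧
      ∃ s, 0 ≤ s ∧ s ≤ ∑ i, μ i * a i ∧ x = ∑ i, μ i • b i + s • y := by
  refine convexHull_min (t := {x | ∃ μ : ι → ℝ, (∀ i, 0 ≤ μ i) ∧ ∑ i, μ i = 1 ∧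
    ∃ s, 0 ≤ s ∧ s ≤ ∑ i, μ i * a i ∧ x = ∑ i, μ i • b i + s • y}) ?_ ?_ hx
  · intro x hx
    obtain ⟨i, k, hk, rfl⟩ := h.exists_eq x hx
    refine ⟨fun j => if j = i then 1 else 0, fun j => ?_, by simp, k, k.cast_nonneg, ?_, by simp⟩
    · dsimp only
      split_ifs <;> norm_num
    · simpa using hk
  · rintro x ⟨μ, hμ, hμ1, s, hs, hsa, rfl⟩ z ⟨ν, hν, hν1, w, hw, hwa, rfl⟩ α β hα hβ hαβ
    refine ⟨fun i => α * μ i + β * ν i, fun i => ?_, ?_, α * s + β * w, ?_, ?_, ?_⟩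
    · exact add_nonneg (mul_nonneg hα (hμ i)) (mul_nonneg hβ (hν i))
    · rw [sum_add_distrib, ← mul_sum, ← mul_sum, hμ1, hν1, mul_one, mul_one, hαβ]
    · positivity
    · simp only [add_mul, mul_assoc, sum_add_distrib, ← mul_sum]
      gcongr
    · simp only [add_smul, mul_smul, sum_add_distrib, ← smul_sum, smul_add]
      abel

theorem exists_of_mem_smul_convexHull (h : IsLineChart A y b a l c) {n : ℕ} {x : V}
    (hx : x ∈ (n : ℝ) • convexHull ℝ (A : Set V)) : ∃ μ : ι → ℝ, (∀ i, 0 ≤ μ i) ∧ ∑ i, μ i = n ∧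
      ∃ s, 0 ≤ s ∧ s ≤ ∑ i, μ i * a i ∧ x = ∑ i, μ i • b i + s • y := by
  obtain ⟨z, hz, rfl⟩ := hx
  obtain ⟨μ, hμ, hμ1, s, hs, hsa, rfl⟩ := h.exists_of_mem_convexHull hz
  refine ⟨fun i => n * μ i, fun i => mul_nonneg n.cast_nonneg (hμ i), ?_, n * s, ?_, ?_, ?_⟩
  · rw [← mul_sum, hμ1, mul_one]
  · positivity
  · simp only [mul_assoc, ← mul_sum]
    gcongr
  · simp only [mul_smul, ← smul_sum, smul_add]

theorem sum_mem_smul_convexHull {n : ℕ} (hn : n ≠ 0) {f : ι → ℕ} (hf : ∑ i, f i = n) {z : ι → V}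
    (hz : ∀ i, z i ∈ A) : ∑ i, (f i : ℝ) • z i ∈ (n : ℝ) • convexHull ℝ (A : Set V) := by
  have hn : (n : ℝ) ≠ 0 := by exact_mod_cast hn
  refine ⟨∑ i, ((f i : ℝ) / n) • z i, (convex_convexHull ℝ _).sum_mem (fun i _ => by positivity) ?_
    fun i _ => subset_convexHull ℝ _ (hz i), ?_⟩
  · rw [← sum_div, ← hf]
    push_cast
    rw [div_self (by rw [← hf] at hn; exact_mod_cast hn)]
  · simp only [smul_sum, smul_smul, mul_div_cancel₀ _ hn]

theorem base_mem (h : IsLineChart A y b a l c) (i : ι) : b i ∈ A := by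
  simpa using h.mem i 0 (Nat.zero_le _)

theorem mem_of_mem_lineSums (h : IsLineChart A y b a l c) (hA : IsSegmentClosed Λ A) (hyΛ : y ∈ Λ)
    {n : ℕ} (hn : n ≠ 0) {x : V} (hx : x ∈ lineSums y b a n) :
    x ∈ Λ ∧ x ∈ (n : ℝ) • convexHull ℝ (A : Set V) := by
  obtain ⟨f, hf, t, ht, rfl⟩ := mem_lineSums.mp hx
  constructor
  · simp only [Nat.cast_smul_eq_nsmul]
    exact Λ.add_mem (Λ.sum_mem fun i _ => Λ.nsmul_mem (hA.1 _ (h.base_mem i)) _)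
      (Λ.nsmul_mem hyΛ _)
  · refine ((convex_convexHull ℝ _).smul _).segment_subset
      (sum_mem_smul_convexHull hn hf h.base_mem)
      (sum_mem_smul_convexHull hn hf fun i => h.mem i (a i) le_rfl) ?_
    have hsum : ∑ i, (f i : ℝ) • (b i + (a i : ℝ) • y) =
        ∑ i, (f i : ℝ) • b i + ((∑ i, f i * a i : ℕ) : ℝ) • y := by
      simp only [smul_add, sum_add_distrib, smul_smul, ← sum_smul]
      push_cast
      rfl
    rw [hsum]
    exact mem_segment_add_smul t.cast_nonneg (by exact_mod_cast ht)

theorem mem_lineSums_of_integral (h : IsLineChart A y b a l c) (hA : IsSegmentClosed Λ A)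
    (hint : ∀ s : ℝ, s • y ∈ Λ → ∃ z : ℤ, s = z) {n : ℕ} {x : V} (hxΛ : x ∈ Λ)
    (hx : x ∈ (n : ℝ) • convexHull ℝ (A : Set V)) (hl : ∀ i, ∃ z : ℤ, l i x - n * c i = z) :
    x ∈ lineSums y b a n := by
  obtain ⟨μ, hμ, hμn, s, hs, hsa, rfl⟩ := h.exists_of_mem_smul_convexHull hx
  have hf : ∀ i, ∃ f : ℕ, μ i = f := fun i => by
    obtain ⟨z, hz⟩ := hl i
    rw [h.apply_sum, hμn, add_sub_cancel_left] at hz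
    have hz0 : 0 ≤ z := by exact_mod_cast hz ▸ hμ i
    lift z to ℕ using hz0
    exact ⟨z, by simpa using hz⟩
  choose f hf using hf
  obtain rfl : μ = fun i => (f i : ℝ) := funext hf
  dsimp only at hμn hsa
  have hbΛ : ∑ i, (f i : ℝ) • b i ∈ Λ := by
    simp only [Nat.cast_smul_eq_nsmul]
    exact Λ.sum_mem fun i _ => Λ.nsmul_mem (hA.1 _ (h.base_mem i)) _
  obtain ⟨z, rfl⟩ := hint s (by simpa using Λ.sub_mem hxΛ hbΛ)
  lift z to ℕ using by exact_mod_cast hs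
  exact mem_lineSums.mpr ⟨f, by exact_mod_cast hμn, z, by exact_mod_cast hsa, by simp⟩

theorem disjoint_lineSums_add (h : IsLineChart A y b a l c) {m n : ℕ} {x : V} {i : ι}
    (hx : ¬∃ z : ℤ, l i x - m * c i = z) :
    Disjoint ((lineSums y b a n).image (x + ·)) (lineSums y b a (m + n)) := by
  rw [disjoint_left]
  intro z hz hz'
  obtain ⟨w, hw, rfl⟩ := mem_image.mp hz
  obtain ⟨f, hf, t, -, rfl⟩ := mem_lineSums.mp hw
  obtain ⟨g, hg, s, -, hgs⟩ := mem_lineSums.mp hz'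
  have h1 := congrArg (l i) hgs
  rw [map_add, h.apply_sum, h.apply_sum, ← Nat.cast_sum, ← Nat.cast_sum, hf, hg] at h1
  refine hx ⟨(g i : ℤ) - f i, ?_⟩
  push_cast at h1 ⊢
  linarith

theorem card_two_le_or (h : IsLineChart A y b a l c) (hA : IsSegmentClosed Λ A) (hyΛ : y ∈ Λ)
    (hint : ∀ s : ℝ, s • y ∈ Λ → ∃ z : ℤ, s = z) {q s : ℕ} (hq : affRank A = q + 1)
    (hs : #A = q + 1 + 1 + s) {L : ℕ → Finset V}
    (hL : ∀ n ≠ 0, ∀ x, x ∈ L n ↔ x ∈ Λ ∧ x ∈ (n : ℝ) • convexHull ℝ (A : Set V)) :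
    #(L 2) ≤ (q + 1 + 2).choose (q + 1) + s * (q + 2).choose (q + 1) ∨
      ∀ n ≠ 0, (q + 1 + (2 + n)).choose (q + 1) + s * (q + (2 + n)).choose (q + 1) +
        ((q + 1 + n).choose (q + 1) + s * (q + n).choose (q + 1)) ≤ #(L (2 + n)) := by
  by_cases hall : ∀ x ∈ L 2, ∀ i, ∃ z : ℤ, l i x - (2 : ℕ) * c i = z
  · left
    rw [← h.card_lineSums hq hs]
    refine card_le_card fun x hx => ?_
    obtain ⟨hxΛ, hxP⟩ := (hL 2 two_ne_zero x).mp hx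
    exact h.mem_lineSums_of_integral hA hint hxΛ hxP (hall x hx)
  · right
    intro n hn
    push Not at hall
    obtain ⟨x, hx, i, hi⟩ := hall
    obtain ⟨hxΛ, hxP⟩ := (hL 2 two_ne_zero x).mp hx
    rw [← h.card_lineSums hq hs, ← h.card_lineSums hq hs,
      ← card_image_of_injective (lineSums y b a n) (add_right_injective x), add_comm,
      ← card_union_of_disjoint (h.disjoint_lineSums_add (not_exists.mpr hi))]
    refine card_le_card (union_subset (fun z hz => ?_) fun z hz =>
      (hL _ (by omega) z).mpr (h.mem_of_mem_lineSums hA hyΛ (by omega) hz))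
    obtain ⟨w, hw, rfl⟩ := mem_image.mp hz
    obtain ⟨hwΛ, hwP⟩ := h.mem_of_mem_lineSums hA hyΛ hn hw
    refine (hL _ (by omega) _).mpr ⟨Λ.add_mem hxΛ hwΛ, ?_⟩
    rw [Nat.cast_add, (convex_convexHull ℝ _).add_smul (Nat.cast_nonneg _) n.cast_nonneg]
    exact Set.add_mem_add hxP hwP

end IsLineChart

theorem doublingExcess_le {A L : Finset V} {q h₁ h₂ : ℕ} (hq : affRank A = q + 1)
    (hcard : #A = q + 1 + 1 + h₁) (hAL : A + A ⊆ L)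
    (hL : #L = (q + 3).choose 2 + h₁ * (q + 2) + h₂) : doublingExcess A ≤ 2 * h₂ := by
  have h1 : (#(A + A) : ℤ) ≤ (q + 3).choose 2 + h₁ * (q + 2) + h₂ := by
    exact_mod_cast (card_le_card hAL).trans hL.le
  have h2 : ((q + 3).choose 2 : ℤ) * 2 = (q + 3) * (q + 2) := by
    have := Nat.add_one_mul_choose_eq (q + 2) 1
    rw [Nat.choose_one_right] at this
    exact_mod_cast this.symm
  unfold doublingExcess
  rw [hq, hcard]
  push_cast
  linarith

theorem eq_zero_or_le_of_card_dilations {Λ : AddSubgroup V} {A : Finset V} {q h₁ h₂ : ℕ}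
    (hq : affRank A = q + 1) (hA : ∀ x, x ∈ A ↔ x ∈ Λ ∧ x ∈ convexHull ℝ (A : Set V))
    {L : ℕ → Finset V}
    (hL : ∀ n ≠ 0, ∀ x, x ∈ L n ↔ x ∈ Λ ∧ x ∈ (n : ℝ) • convexHull ℝ (A : Set V))
    (hcard : ∀ n ≠ 0, #(L n) = (n + (q + 1)).choose (q + 1) +
      h₁ * (n + (q + 1) - 1).choose (q + 1) + h₂ * (n + (q + 1) - 2).choose (q + 1)) :
    h₂ = 0 ∨ h₁ ≤ 3 * h₂ + 3 ∨ h₁ = 7 ∧ h₂ = 1 := by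
  by_contra! hcon
  obtain ⟨h2, h1, hexcep⟩ := hcon
  have hA1 : L 1 = A := by
    ext x
    rw [hL 1 one_ne_zero, hA x, Nat.cast_one, one_smul]
  have hAcard : #A = q + 1 + 1 + h₁ := by
    rw [← hA1, hcard 1 one_ne_zero, show 1 + (q + 1) = q + 1 + 1 by ring, Nat.choose_succ_self_right]
    simp
  have hAc : IsSegmentClosed Λ A := ⟨fun x hx => ((hA x).mp hx).1, fun x hx z hz w hw hws =>
    (hA w).mpr ⟨hw, (convex_convexHull ℝ _).segment_subset ((hA x).mp hx).2 ((hA z).mp hz).2 hws⟩⟩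
  have hne : A.Nonempty := card_pos.mp (by omega)
  have hL2 : #(L 2) = (q + 3).choose 2 + h₁ * (q + 2) + h₂ := by
    rw [hcard 2 two_ne_zero, show 2 + (q + 1) = q + 1 + 2 by ring, Nat.choose_symm_add,
      show q + 1 + 2 - 1 = q + 1 + 1 by omega, Nat.choose_succ_self_right]
    simp
  have hexc : doublingExcess A ≤ 2 * h₂ := by
    refine doublingExcess_le hq hAcard (fun x hx => ?_) hL2
    obtain ⟨z, hz, w, hw, rfl⟩ := mem_add.mp hx
    obtain ⟨hzΛ, hzP⟩ := (hA z).mp hz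
    obtain ⟨hwΛ, hwP⟩ := (hA w).mp hw
    refine (hL 2 two_ne_zero _).mpr ⟨Λ.add_mem hzΛ hwΛ, ?_⟩
    rw [show ((2 : ℕ) : ℝ) = 1 + 1 by norm_num,
      (convex_convexHull ℝ _).add_smul zero_le_one zero_le_one, one_smul]
    exact Set.add_mem_add hzP hwP
  have hs : surplus A = h₁ := by
    unfold surplus
    rw [hAcard, hq]
    push_cast
    ring
  obtain ⟨y, hstep, hcov⟩ := (coveredByLines_of_doublingExcess_le hne hAc (by omega)
    (by omega)).exists_isStep hAc
  obtain ⟨b, a, l, c, h⟩ := exists_isLineChart hne hstep hcov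
  obtain ⟨i, hi⟩ : ∃ i, 1 ≤ a i := by
    by_contra! h0
    have := h.sum_eq
    simp only [fun i => Nat.lt_one_iff.mp (h0 i), sum_const, card_univ, h.card_eq, hq] at this
    simp at this
    omega
  have hby : b i + y ∈ A := by simpa using h.mem i 1 hi
  have hyΛ : y ∈ Λ := by
    simpa using Λ.sub_mem (hAc.1 _ hby) (hAc.1 _ (h.base_mem i))
  rcases h.card_two_le_or hAc hyΛ (fun s hs => hstep.exists_int_eq hAc (h.base_mem i) hby hs) hq
    hAcard hL with hle | hle
  · rw [hL2, Nat.choose_symm_add, show q + 2 = q + 1 + 1 by ring, Nat.choose_succ_self_right,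
      show q + 1 + 2 = q + 3 by ring] at hle
    omega
  · have := hle (q + 1) q.succ_ne_zero
    rw [hcard _ (by omega), show 2 + (q + 1) + (q + 1) = q + 1 + (2 + (q + 1)) by ring,
      show q + 1 + (2 + (q + 1)) - 1 = q + (2 + (q + 1)) by omega,
      show q + 1 + (2 + (q + 1)) - 2 = 2 * q + 1 + 1 by omega,
      show q + 1 + (q + 1) = 2 * q + 1 + 1 by omega,
      show q + (q + 1) = 2 * q + 1 by omega, Nat.choose_succ_succ (2 * q + 1) q,
      ← Nat.choose_symm_half] at this
    have hpos : 0 < (2 * q + 1).choose (q + 1) := Nat.choose_pos (by omega)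
    have hlt : 2 + h₁ ≤ 2 * h₂ := Nat.le_of_mul_le_mul_right (by linarith) hpos
    omega

/-- The coercion of integer points to real points, as a homomorphism. -/
def latticeHom (d : ℕ) : (Fin d → ℤ) →+ (Fin d → ℝ) where
  toFun := toReal
  map_zero' := by ext; simp [toReal]
  map_add' x y := by ext; simp [toReal]

theorem toReal_injective {d : ℕ} : Function.Injective (toReal (d := d)) := fun _ _ h =>
  funext fun i => Int.cast_injective (α := ℝ) (congrFun h i)

theorem affRank_eq_of_convexHull {d : ℕ} {A : Finset (Fin d → ℝ)}
    (hA : affineSpan ℝ (convexHull ℝ (A : Set (Fin d → ℝ))) = ⊤) : affRank A = d := by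
  rw [affineSpan_convexHull] at hA
  rw [affRank, ← direction_affineSpan, hA, AffineSubspace.direction_top, finrank_top,
    finrank_fin_fun]

theorem exists_finset_latticePoints {d n : ℕ} {P : Set (Fin d → ℝ)} (hn : latticeCount P n ≠ 0) :
    ∃ L : Finset (Fin d → ℝ), #L = latticeCount P n ∧
      ∀ x, x ∈ L ↔ x ∈ (latticeHom d).range ∧ x ∈ (n : ℝ) • P := by
  have hfin := Set.finite_of_ncard_ne_zero hn
  refine ⟨hfin.toFinset.image toReal, ?_, fun x => ?_⟩
  · rw [card_image_of_injective _ toReal_injective, latticeCount, Set.ncard_eq_toFinset_card _ hfin]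
  · simp only [mem_image, Set.Finite.mem_toFinset, Set.mem_ofPred_eq, AddMonoidHom.mem_range]
    constructor
    · rintro ⟨z, hz, rfl⟩
      exact ⟨⟨z, rfl⟩, hz⟩
    · rintro ⟨⟨z, rfl⟩, hz⟩
      exact ⟨z, hz, rfl⟩

theorem eq_zero_or_le_of_latticeCount {q : ℕ} {P : Set (Fin (q + 1) → ℝ)}
    (hP : IsFullDimLatticePolytope P) {h₁ h₂ : ℕ}
    (hcount : ∀ n : ℕ, 1 ≤ n → latticeCount P n = (n + (q + 1)).choose (q + 1) +
      h₁ * (n + (q + 1) - 1).choose (q + 1) + h₂ * (n + (q + 1) - 2).choose (q + 1)) :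
    h₂ = 0 ∨ h₁ ≤ 3 * h₂ + 3 ∨ h₁ = 7 ∧ h₂ = 1 := by
  obtain ⟨W, hPW, htop⟩ := hP
  choose! L hLcard hL using fun n (hn : n ≠ 0) => exists_finset_latticePoints (P := P) (n := n) (by
    rw [hcount n (Nat.one_le_iff_ne_zero.mpr hn)]
    have := Nat.choose_pos (Nat.le_add_left (q + 1) n)
    omega)
  have hL1 : ∀ x, x ∈ L 1 ↔ x ∈ (latticeHom (q + 1)).range ∧ x ∈ P := fun x => by
    rw [hL 1 one_ne_zero, Nat.cast_one, one_smul]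
  have hconv : convexHull ℝ (L 1 : Set (Fin (q + 1) → ℝ)) = P := by
    refine (convexHull_min (fun x hx => ((hL1 x).mp hx).2) ?_).antisymm ?_
    · rw [hPW]
      exact convex_convexHull ℝ _
    · conv_lhs => rw [hPW]
      refine convexHull_mono ?_
      rintro _ ⟨z, hz, rfl⟩
      exact (hL1 _).mpr ⟨⟨z, rfl⟩, hPW ▸ subset_convexHull ℝ _ ⟨z, hz, rfl⟩⟩
  refine eq_zero_or_le_of_card_dilations (Λ := (latticeHom (q + 1)).range) (A := L 1) (L := L)
    (affRank_eq_of_convexHull (hconv.symm ▸ htop)) ?_ ?_ fun n hn => ?_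
  · rwa [hconv]
  · rwa [hconv]
  · rw [hLcard n hn, hcount n (Nat.one_le_iff_ne_zero.mpr hn)]

end Treutlein

/-- Treutlein: a lattice polytope of degree at most two with
h*-polynomial `1 + h₁* t + h₂* t²` satisfies `h₂* = 0`, or `h₁* ≤ 3h₂* + 3`,
or `(h₁*, h₂*) = (7, 1)`. -/
theorem stmt17 (d : ℕ) (P : Set (Fin d → ℝ)) (hP : IsFullDimLatticePolytope P)
    (h1 h2 : ℕ)
    (hcount : ∀ n : ℕ, 1 ≤ n →
      latticeCount P n =
        Nat.choose (n + d) d + h1 * Nat.choose (n + d - 1) d +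
          h2 * Nat.choose (n + d - 2) d) :
    h2 = 0 ∨ h1 ≤ 3 * h2 + 3 ∨ (h1 = 7 ∧ h2 = 1) := by
  rcases d with - | q
  · have h := hcount 1 le_rfl
    have hle : latticeCount P 1 ≤ 1 := Set.ncard_le_one_of_subsingleton _
    rw [h] at hle
    simp only [Nat.choose_zero_right, mul_one] at hle
    omega
  · exact eq_zero_or_le_of_latticeCount hP hcount
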